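/- arXiv:2101.00161 — 2 statements merged into one kernel-verified Lean document; each statement's English description precedes it below -/
import Mathlib

section
/- Consider the heterogeneous multi-agent system ẋ_i = f_i(t, x_i) + k·Σ_{j∈N_i} α_{ij}(x_j − x_i) ∈ ℝ^n for i = 1,…,N over an undirected connected weighted graph, and its blended dynamics ṡ = (1/N)·Σ_{i=1}^N f_i(t, s) on ℝ^n. Assume the blended dynamics is contractive. Then for every compact set K ⊂ ℝ^{nN} and every η > 0 there exists k* > 0 such that for every k > k* and every initial condition with (x_1(t₀),…,x_N(t₀)) ∈ K, the solution of the network exists for all t ≥ t₀ and satisfies limsup_{t→∞} ‖x_i(t) − s(t)‖ ≤ η for every i ∈ {1,…,N}, where s(·) is the solution of the blended dynamics with s(t₀) = (1/N)·Σ_{i=1}^N x_i(t₀). -/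
open Filter Matrix

/-- Euclidean norm of a finitely-indexed real vector. -/
noncomputable def eunorm {ι : Type*} [Fintype ι] (v : ι → ℝ) : ℝ :=
  Real.sqrt (∑ j, v j ^ 2)

/-- `limsup_{t→∞} g(t) ≤ c`. -/
def LimsupLE (g : ℝ → ℝ) (c : ℝ) : Prop :=
  ∀ ε > 0, ∃ T : ℝ, ∀ t ≥ T, g t ≤ c + ε

/-- Laplacian matrix `𝓛 = D - A` of the weighted graph with weights `α`. -/
noncomputable def lapMat {N : ℕ} (α : Fin N → Fin N → ℝ) : Matrix (Fin N) (Fin N) ℝ :=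
  Matrix.of fun i j => (if i = j then ∑ l, α i l else 0) - α i j

/-- Regularity of a time-varying vector field: continuity, C¹ in the state,
local Lipschitzness in the state uniformly in `t`, and boundedness of `f(t,0)`. -/
def Reg {n : ℕ} (f : ℝ → (Fin n → ℝ) → Fin n → ℝ) : Prop :=
  Continuous (Function.uncurry f) ∧
  (∀ t, ContDiff ℝ 1 (f t)) ∧
  (∀ x₀ : Fin n → ℝ, ∃ L : NNReal, ∃ ε > 0, ∀ t, LipschitzOnWith L (f t) (Metric.ball x₀ ε)) ∧
  (∃ C : ℝ, ∀ t, eunorm (f t 0) ≤ C)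

/-- Contractivity of `ṡ = F(t,s)`: there is a symmetric positive definite `Θ` with
`Θ·(∂F/∂s) + (∂F/∂s)ᵀ·Θ ⪯ -I` everywhere. -/
def Contractive {ι : Type*} [Fintype ι] [DecidableEq ι]
    (F : ℝ → (ι → ℝ) → ι → ℝ) : Prop :=
  ∃ Θ : Matrix ι ι ℝ, Θ.PosDef ∧
    ∀ (t : ℝ) (s : ι → ℝ), ∃ J : Matrix ι ι ℝ,
      HasFDerivAt (F t) (LinearMap.toContinuousLinearMap J.mulVecLin) s ∧
      (-1 - (Θ * J + Jᵀ * Θ) : Matrix ι ι ℝ).PosSemidef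


section ode
open Set Metric

theorem bs_global_exists {E : Type*} [NormedAddCommGroup E] [NormedSpace ℝ E] [CompleteSpace E]
    (G : ℝ → E → E) (L B : NNReal) (hL : ∀ t, LipschitzWith L (G t))
    (hc : ∀ x, Continuous fun t => G t x) (hB : ∀ t x, ‖G t x‖ ≤ B) (t₀ : ℝ) (x₀ : E) :
    ∃ x : ℝ → E, x t₀ = x₀ ∧ ∀ t, HasDerivAt x (G t (x t)) t := by
  have step : ∀ T : ℕ, ∃ x : ℝ → E, x t₀ = x₀ ∧
      ∀ t ∈ Ioo (t₀ - (T + 1)) (t₀ + (T + 1)), HasDerivAt x (G t (x t)) t := by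
    intro T
    have hT : (0 : ℝ) ≤ (T : ℝ) + 1 := by positivity
    have hp : IsPicardLindelof G (tmin := t₀ - (T + 1)) (tmax := t₀ + (T + 1))
        ⟨t₀, by constructor <;> linarith⟩ x₀ (B * (T + 1)) 0 B L := by
      refine ⟨fun t _ => (hL t).lipschitzOnWith, fun x _ => (hc x).continuousOn,
        fun t _ x _ => hB t x, ?_⟩
      simp
    obtain ⟨x, hx0, hx⟩ := hp.exists_eq_forall_mem_Icc_hasDerivWithinAt₀
    exact ⟨x, hx0, fun t ht => (hx t (Ioo_subset_Icc_self ht)).hasDerivAt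
      (Icc_mem_nhds ht.1 ht.2)⟩
  choose y hy0 hy using step
  have agree : ∀ S T : ℕ, S ≤ T → EqOn (y S) (y T) (Ioo (t₀ - (S + 1)) (t₀ + (S + 1))) := by
    intro S T hST
    have hS : (0 : ℝ) ≤ (S : ℝ) := by positivity
    have hST' : (S : ℝ) ≤ T := by exact_mod_cast hST
    refine ODE_solution_unique_of_mem_Ioo (v := G) (s := fun _ => univ) (t₀ := t₀)
      (fun t _ => (hL t).lipschitzOnWith) (by constructor <;> linarith)
      (fun t ht => ⟨hy S t ht, mem_univ _⟩) (fun t ht => ⟨hy T t ?_, mem_univ _⟩) ?_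
    · exact ⟨by linarith [ht.1], by linarith [ht.2]⟩
    · rw [hy0, hy0]
  have mem : ∀ (t : ℝ) (S : ℕ), |t - t₀| < S + 1 → t ∈ Ioo (t₀ - ((S : ℝ) + 1)) (t₀ + (S + 1)) := by
    intro t S h
    rw [abs_lt] at h
    constructor <;> linarith [h.1, h.2]
  have mem0 : ∀ t : ℝ, |t - t₀| < (⌈|t - t₀|⌉₊ : ℝ) + 1 := fun t => by
    linarith [Nat.le_ceil |t - t₀|]
  refine ⟨fun t => y ⌈|t - t₀|⌉₊ t, by simp [hy0], fun t => ?_⟩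
  set T := ⌈|t - t₀|⌉₊ + 1 with hT
  have htT : |t - t₀| < (⌈|t - t₀|⌉₊ : ℝ) + 1 := mem0 t
  have e1 : y T t = y ⌈|t - t₀|⌉₊ t := ((agree _ T (Nat.le_succ _)) (mem t _ htT)).symm
  have hd := hy T t (mem t T (by rw [hT]; push_cast; linarith))
  show HasDerivAt _ (G t (y ⌈|t - t₀|⌉₊ t)) t
  rw [← e1]
  refine hd.congr_of_eventuallyEq ?_
  filter_upwards [Ioo_mem_nhds (mem t _ htT).1 (mem t _ htT).2] with u hu
  refine agree _ T ?_ (mem u _ (mem0 u))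
  have : |u - t₀| ≤ (T : ℝ) := by
    rw [abs_le, hT]; push_cast; constructor <;> linarith [hu.1, hu.2]
  exact Nat.ceil_le.2 this

/-- coordinatewise clamp -/
theorem bs_clamp1 {n : ℕ} (R : ℝ) (hR : 0 ≤ R) :
    ∃ P : (Fin n → ℝ) → (Fin n → ℝ), LipschitzWith 1 P ∧ (∀ x, ‖P x‖ ≤ R) ∧
      ∀ x, ‖x‖ ≤ R → P x = x := by
  refine ⟨fun x j => max (-R) (min R (x j)), ?_, ?_, ?_⟩
  · refine LipschitzWith.of_dist_le_mul fun x y => ?_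
    rw [NNReal.coe_one, one_mul, dist_pi_le_iff dist_nonneg]
    intro j
    refine le_trans ?_ (dist_le_pi_dist x y j)
    have := ((LipschitzWith.id (α := ℝ)).const_min R).const_max (-R)
    simpa using this.dist_le_mul (x j) (y j)
  · intro x
    rw [pi_norm_le_iff_of_nonneg hR]
    intro j
    rw [Real.norm_eq_abs, abs_le]
    exact ⟨le_max_left _ _, max_le (by linarith) (min_le_left _ _)⟩
  · intro x hx
    ext j
    have := (norm_le_pi_norm x j).trans hx
    rw [Real.norm_eq_abs, abs_le] at this
    show max (-R) (min R (x j)) = x j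
    rw [min_eq_right this.2, max_eq_right this.1]

theorem bs_clamp2 {N n : ℕ} (R : ℝ) (hR : 0 ≤ R) :
    ∃ P : (Fin N → Fin n → ℝ) → (Fin N → Fin n → ℝ), LipschitzWith 1 P ∧ (∀ x, ‖P x‖ ≤ R) ∧
      ∀ x, ‖x‖ ≤ R → P x = x := by
  obtain ⟨P, h1, h2, h3⟩ := bs_clamp1 (n := n) R hR
  refine ⟨fun x i => P (x i), ?_, ?_, ?_⟩
  · refine LipschitzWith.of_dist_le_mul fun x y => ?_
    rw [NNReal.coe_one, one_mul, dist_pi_le_iff dist_nonneg]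
    intro j
    refine le_trans ?_ (dist_le_pi_dist x y j)
    simpa using h1.dist_le_mul (x j) (y j)
  · intro x
    rw [pi_norm_le_iff_of_nonneg hR]
    exact fun j => h2 _
  · intro x hx
    ext1 j
    exact h3 _ ((norm_le_pi_norm x j).trans hx)

theorem bs_trunc {E : Type*} [NormedAddCommGroup E] [NormedSpace ℝ E] [CompleteSpace E]
    (G : ℝ → E → E) (L : NNReal) (R C : ℝ)
    (hP : ∃ P : E → E, LipschitzWith 1 P ∧ (∀ x, ‖P x‖ ≤ R) ∧ ∀ x, ‖x‖ ≤ R → P x = x)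
    (hL : ∀ t, LipschitzOnWith L (G t) (closedBall 0 R))
    (hc : ∀ x, Continuous fun t => G t x) (hB : ∀ t x, ‖x‖ ≤ R → ‖G t x‖ ≤ C)
    (t₀ : ℝ) (x₀ : E) :
    ∃ x x' : ℝ → E, x t₀ = x₀ ∧ (∀ t, HasDerivAt x (x' t) t) ∧
      ∀ t, ‖x t‖ ≤ R → x' t = G t (x t) := by
  obtain ⟨P, h1, h2, h3⟩ := hP
  obtain ⟨x, hx0, hx⟩ := bs_global_exists (fun t x => G t (P x)) L C.toNNReal
    (fun t => by
      have := (hL t).comp (h1.lipschitzOnWith (s := univ)) (fun x _ => by simpa using h2 x)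
      rw [mul_one] at this
      exact lipschitzOnWith_univ.1 this)
    (fun x => hc _) (fun t x => (hB t _ (h2 x)).trans (Real.le_coe_toNNReal C)) t₀ x₀
  exact ⟨x, fun t => G t (P (x t)), hx0, hx, fun t ht => by simp only [h3 _ ht]⟩

theorem bs_lyap (W W' : ℝ → ℝ) (t₀ R c ρ : ℝ) (hc : 0 < c) (hρ : ρ < R)
    (hW : ∀ t ≥ t₀, HasDerivAt W (W' t) t) (h0 : W t₀ ≤ R)
    (hd : ∀ t ≥ t₀, W t ≤ R → W' t ≤ - c * (W t - ρ)) :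
    (∀ t ≥ t₀, W t ≤ R) ∧ ∀ t ≥ t₀, W t ≤ ρ + (R - ρ) * Real.exp (- c * (t - t₀)) := by
  have inv : ∀ t ≥ t₀, W t ≤ R := by
    intro t ht
    refine image_le_of_deriv_right_lt_deriv_boundary (f := W) (f' := W') (a := t₀) (b := t)
      (B := fun _ => R) (B' := fun _ => 0)
      (fun u hu => (hW u hu.1).continuousAt.continuousWithinAt)
      (fun u hu => (hW u hu.1).hasDerivWithinAt) h0 (fun u => hasDerivAt_const u R) ?_
      (right_mem_Icc.2 ht)
    intro u hu hWu
    have hWu' : W u = R := hWu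
    have := hd u hu.1 hWu'.le
    rw [hWu'] at this
    nlinarith
  refine ⟨inv, fun t ht => ?_⟩
  have hder : ∀ u ≥ t₀, HasDerivAt (fun u => (W u - ρ) * Real.exp (c * (u - t₀)))
      (W' u * Real.exp (c * (u - t₀)) + (W u - ρ) * (Real.exp (c * (u - t₀)) * (c * 1))) u := by
    intro u hu
    exact ((hW u hu).sub_const ρ).mul ((((hasDerivAt_id u).sub_const t₀).const_mul c).exp)
  have anti : AntitoneOn (fun u => (W u - ρ) * Real.exp (c * (u - t₀))) (Ici t₀) := by
    refine antitoneOn_of_deriv_nonpos (convex_Ici t₀)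
      (fun u hu => (hder u hu).continuousAt.continuousWithinAt)
      (fun u hu => ?_) (fun u hu => ?_)
    · rw [interior_Ici] at hu
      exact (hder u (le_of_lt hu)).differentiableAt.differentiableWithinAt
    · rw [interior_Ici] at hu
      have hu' : u ≥ t₀ := le_of_lt hu
      rw [(hder u hu').deriv]
      have h1 := hd u hu' (inv u hu')
      have h2 := Real.exp_pos (c * (u - t₀))
      nlinarith
  have h := anti (mem_Ici.2 le_rfl) (mem_Ici.2 ht) ht
  simp only [sub_self, mul_zero, Real.exp_zero, mul_one] at h
  have hE := Real.exp_pos (- c * (t - t₀))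
  have hEE : Real.exp (c * (t - t₀)) * Real.exp (- c * (t - t₀)) = 1 := by
    rw [← Real.exp_add]; simp
  have : (W t - ρ) = (W t - ρ) * Real.exp (c * (t - t₀)) * Real.exp (- c * (t - t₀)) := by
    rw [mul_assoc, hEE, mul_one]
  have h3 : (W t - ρ) ≤ (R - ρ) * Real.exp (- c * (t - t₀)) := by
    rw [this]
    exact mul_le_mul_of_nonneg_right (h.trans (by linarith)) hE.le
  linarith

end ode

section alg
open Set Metric

theorem bs_dot_nonneg {ι : Type*} [Fintype ι] (v : ι → ℝ) : 0 ≤ v ⬝ᵥ v :=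
  Finset.sum_nonneg fun _ _ => mul_self_nonneg _

theorem bs_dot_pos {ι : Type*} [Fintype ι] {v : ι → ℝ} (hv : v ≠ 0) : 0 < v ⬝ᵥ v :=
  lt_of_le_of_ne (bs_dot_nonneg v) fun h => hv (dotProduct_self_eq_zero.1 h.symm)

theorem bs_coord_le {ι : Type*} [Fintype ι] (v : ι → ℝ) (i : ι) : v i ^ 2 ≤ v ⬝ᵥ v := by
  have := Finset.single_le_sum (f := fun i => v i * v i) (fun i _ => mul_self_nonneg _)
    (Finset.mem_univ i)
  simpa [dotProduct, sq] using this

theorem bs_norm_sq_le {ι : Type*} [Fintype ι] (v : ι → ℝ) : ‖v‖ ^ 2 ≤ v ⬝ᵥ v := by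
  have : ‖v‖ ≤ Real.sqrt (v ⬝ᵥ v) := by
    rw [pi_norm_le_iff_of_nonneg (Real.sqrt_nonneg _)]
    intro i
    rw [Real.norm_eq_abs]
    exact Real.abs_le_sqrt (bs_coord_le v i)
  calc ‖v‖ ^ 2 ≤ Real.sqrt (v ⬝ᵥ v) ^ 2 := by gcongr
    _ = _ := Real.sq_sqrt (bs_dot_nonneg v)

theorem bs_dot_le_norm {n : ℕ} (v : Fin n → ℝ) : v ⬝ᵥ v ≤ n * ‖v‖ ^ 2 := by
  calc v ⬝ᵥ v ≤ ∑ _i : Fin n, ‖v‖ ^ 2 := by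
        refine Finset.sum_le_sum fun i _ => ?_
        have := norm_le_pi_norm v i
        rw [Real.norm_eq_abs] at this
        nlinarith [abs_nonneg (v i), abs_mul_abs_self (v i)]
    _ = _ := by simp

theorem bs_young {ι : Type*} [Fintype ι] (v w : ι → ℝ) (m : ℝ) (hm : 0 < m) :
    2 * (v ⬝ᵥ w) ≤ m * (v ⬝ᵥ v) + (w ⬝ᵥ w) / m := by
  simp only [dotProduct, Finset.mul_sum, Finset.sum_div, ← Finset.sum_add_distrib]
  refine Finset.sum_le_sum fun i _ => ?_
  have : m * (v i * v i) + w i * w i / m - 2 * (v i * w i) = (m * v i - w i) ^ 2 / m := by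
    field_simp; ring
  have h2 : 0 ≤ (m * v i - w i) ^ 2 / m := by positivity
  linarith

theorem bs_quad_bounds {ι : Type*} [Fintype ι] (S : Set (ι → ℝ)) (hS : IsClosed S)
    (hSs : ∀ (c : ℝ), ∀ v ∈ S, c • v ∈ S) (M : Matrix ι ι ℝ) :
    (∃ θ > 0, ∀ v ∈ S, v ⬝ᵥ M *ᵥ v ≤ θ * (v ⬝ᵥ v)) ∧
    ((∀ v ∈ S, v ≠ 0 → 0 < v ⬝ᵥ M *ᵥ v) → ∃ m > 0, ∀ v ∈ S, m * (v ⬝ᵥ v) ≤ v ⬝ᵥ M *ᵥ v) := by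
  have hq : Continuous fun v : ι → ℝ => v ⬝ᵥ M *ᵥ v :=
    continuous_id.dotProduct (continuous_const.matrix_mulVec continuous_id)
  have hn : Continuous fun v : ι → ℝ => v ⬝ᵥ v := continuous_id.dotProduct continuous_id
  let U : Set (ι → ℝ) := S ∩ {v | v ⬝ᵥ v = 1}
  have hU : IsCompact U := by
    refine Metric.isCompact_of_isClosed_isBounded (hS.inter (isClosed_eq hn continuous_const)) ?_
    refine (isBounded_closedBall (x := (0 : ι → ℝ)) (r := 1)).subset fun v hv => ?_
    have h1 := bs_norm_sq_le v
    have h2 : v ⬝ᵥ v = 1 := hv.2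
    rw [mem_closedBall_zero_iff]
    nlinarith [norm_nonneg v]
  have scale : ∀ v ∈ S, v ≠ 0 → ∃ u ∈ U, v ⬝ᵥ M *ᵥ v = (v ⬝ᵥ v) * (u ⬝ᵥ M *ᵥ u) := by
    intro v hv hv0
    have hp := bs_dot_pos hv0
    have hs := Real.mul_self_sqrt hp.le
    have hsp := Real.sqrt_pos.2 hp
    refine ⟨(Real.sqrt (v ⬝ᵥ v))⁻¹ • v, ⟨hSs _ v hv, ?_⟩, ?_⟩
    · simp only [mem_ofPred_eq, smul_dotProduct, dotProduct_smul, smul_eq_mul]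
      field_simp
      nlinarith
    · simp only [smul_dotProduct, dotProduct_smul, smul_eq_mul, mulVec_smul]
      field_simp
      rw [sq, hs, mul_comm]
  constructor
  · obtain ⟨C, hC⟩ := hU.bddAbove_image (f := fun v => v ⬝ᵥ M *ᵥ v) hq.continuousOn
    refine ⟨max C 1, by positivity, fun v hv => ?_⟩
    by_cases hv0 : v = 0
    · simp [hv0]
    obtain ⟨u, hu, he⟩ := scale v hv hv0
    have : u ⬝ᵥ M *ᵥ u ≤ C := hC ⟨u, hu, rfl⟩
    rw [he, mul_comm]
    exact mul_le_mul_of_nonneg_right (this.trans (le_max_left _ _)) (bs_dot_nonneg v)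
  · intro hpos
    rcases U.eq_empty_or_nonempty with hE | hne
    · refine ⟨1, one_pos, fun v hv => ?_⟩
      by_cases hv0 : v = 0
      · simp [hv0]
      obtain ⟨u, hu, he⟩ := scale v hv hv0
      rw [hE] at hu
      exact hu.elim
    · obtain ⟨w, hw, hmin⟩ := hU.exists_isMinOn hne (f := fun v => v ⬝ᵥ M *ᵥ v) hq.continuousOn
      have hw0 : w ≠ 0 := by
        rintro rfl
        have : (0 : ι → ℝ) ⬝ᵥ 0 = 1 := hw.2
        simp at this
      refine ⟨w ⬝ᵥ M *ᵥ w, hpos w hw.1 hw0, fun v hv => ?_⟩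
      by_cases hv0 : v = 0
      · simp [hv0]
      obtain ⟨u, hu, he⟩ := scale v hv hv0
      have : w ⬝ᵥ M *ᵥ w ≤ u ⬝ᵥ M *ᵥ u := hmin hu
      rw [he, mul_comm]
      exact mul_le_mul_of_nonneg_left this (bs_dot_nonneg v)

theorem bs_symm_dot {ι : Type*} [Fintype ι] {M : Matrix ι ι ℝ} (hM : Mᵀ = M) (v w : ι → ℝ) :
    v ⬝ᵥ M *ᵥ w = w ⬝ᵥ M *ᵥ v := by
  rw [dotProduct_comm, ← vecMul_transpose, hM, ← dotProduct_mulVec]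

theorem bs_symm_dot2 {ι : Type*} [Fintype ι] {M : Matrix ι ι ℝ} (hM : Mᵀ = M) (v w : ι → ℝ) :
    v ⬝ᵥ M *ᵥ w = (M *ᵥ v) ⬝ᵥ w := by
  rw [bs_symm_dot hM, dotProduct_comm]

/-- Contraction inequality in integrated form. -/
theorem bs_contr {n : ℕ} {F : ℝ → (Fin n → ℝ) → Fin n → ℝ} (h : Contractive F) :
    ∃ Θ : Matrix (Fin n) (Fin n) ℝ, Θ.PosDef ∧ Θᵀ = Θ ∧
      ∀ t x y, 2 * ((x - y) ⬝ᵥ Θ *ᵥ (F t x - F t y)) ≤ - ((x - y) ⬝ᵥ (x - y)) := by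
  obtain ⟨Θ, hΘ, hJ⟩ := h
  have hsy : Θᵀ = Θ := by
    have := hΘ.isHermitian.eq
    rwa [conjTranspose_eq_transpose_of_trivial] at this
  refine ⟨Θ, hΘ, hsy, fun t x y => ?_⟩
  choose J hJ1 hJ2 using hJ t
  set v := x - y with hv
  let g : ℝ → ℝ := fun τ => v ⬝ᵥ Θ *ᵥ (F t (y + τ • v))
  let D : (Fin n → ℝ) →L[ℝ] ℝ := LinearMap.toContinuousLinearMap
    { toFun := fun w => v ⬝ᵥ Θ *ᵥ w
      map_add' := fun a b => by rw [mulVec_add, dotProduct_add]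
      map_smul' := fun c a => by simp [mulVec_smul, dotProduct_smul] }
  have hg : ∀ τ, HasDerivAt g (v ⬝ᵥ Θ *ᵥ (J (y + τ • v) *ᵥ v)) τ := by
    intro τ
    have h1 : HasDerivAt (fun τ : ℝ => y + τ • v) v τ := by
      simpa using ((hasDerivAt_id τ).smul_const v).const_add y
    have h2 := (hJ1 (y + τ • v)).comp_hasDerivAt τ h1
    exact D.hasFDerivAt.comp_hasDerivAt τ h2
  obtain ⟨τ, -, hτ⟩ := exists_hasDerivAt_eq_slope g _ (zero_lt_one)
    (fun u _ => (hg u).continuousAt.continuousWithinAt) (fun u _ => hg u)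
  have hneg := (hJ2 (y + τ • v)).dotProduct_mulVec_nonneg v
  set A := J (y + τ • v)
  simp only [star_trivial, sub_mulVec, neg_mulVec, one_mulVec, add_mulVec, ← mulVec_mulVec,
    dotProduct_sub, dotProduct_neg, dotProduct_add] at hneg
  have e : v ⬝ᵥ Aᵀ *ᵥ Θ *ᵥ v = v ⬝ᵥ Θ *ᵥ A *ᵥ v := by
    rw [bs_symm_dot2 hsy, dotProduct_mulVec, vecMul_transpose, dotProduct_comm]
  have e2 : g 1 - g 0 = v ⬝ᵥ Θ *ᵥ (F t x - F t y) := by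
    simp [g, mulVec_sub, dotProduct_sub, hv]
  rw [sub_zero, div_one, e2] at hτ
  rw [← hτ]
  linarith

theorem bs_lip {n : ℕ} {f : ℝ → (Fin n → ℝ) → Fin n → ℝ} (h : Reg f) (R : ℝ) :
    ∃ L : NNReal, ∀ t, LipschitzOnWith L (f t) (closedBall 0 R) := by
  obtain ⟨-, hC1, hlip, -⟩ := h
  have key : ∃ L : NNReal, ∀ x ∈ closedBall (0 : Fin n → ℝ) R, ∀ t, ‖fderiv ℝ (f t) x‖₊ ≤ L := by
    refine IsCompact.induction_on (isCompact_closedBall (0 : Fin n → ℝ) R)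
      (p := fun S => ∃ L : NNReal, ∀ x ∈ S, ∀ t, ‖fderiv ℝ (f t) x‖₊ ≤ L) ?_ ?_ ?_ ?_
    · exact ⟨0, by simp⟩
    · rintro s t hst ⟨L, hL⟩
      exact ⟨L, fun x hx => hL x (hst hx)⟩
    · rintro s t ⟨L, hL⟩ ⟨L', hL'⟩
      refine ⟨max L L', fun x hx τ => ?_⟩
      rcases hx with hx | hx
      · exact (hL x hx τ).trans (le_max_left _ _)
      · exact (hL' x hx τ).trans (le_max_right _ _)
    · intro x _
      obtain ⟨L, ε, hε, hL⟩ := hlip x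
      refine ⟨ball x ε, mem_nhdsWithin_of_mem_nhds (ball_mem_nhds x hε), L, fun y hy t => ?_⟩
      have := norm_fderiv_le_of_lipschitzOn ℝ (isOpen_ball.mem_nhds hy) (hL t)
      exact this
  obtain ⟨L, hL⟩ := key
  exact ⟨L, fun t => (convex_closedBall 0 R).lipschitzOnWith_of_nnnorm_fderiv_le
    (fun x _ => ((hC1 t).differentiable (by norm_num)).differentiableAt) (fun x hx => hL x hx t)⟩

theorem bs_bound0 {n : ℕ} {f : ℝ → (Fin n → ℝ) → Fin n → ℝ} (h : Reg f) :
    ∃ C : ℝ, 0 ≤ C ∧ ∀ t, ‖f t 0‖ ≤ C := by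
  obtain ⟨-, -, -, C, hC⟩ := h
  refine ⟨C, (Real.sqrt_nonneg _).trans (hC 0), fun t => ?_⟩
  refine le_trans ?_ (hC t)
  have := bs_norm_sq_le (f t 0)
  have e : f t 0 ⬝ᵥ f t 0 = ∑ j, f t 0 j ^ 2 := by simp [dotProduct, sq]
  rw [e] at this
  exact Real.le_sqrt_of_sq_le this

/-- uniform constants for all agents -/
theorem bs_unif {N n : ℕ} {f : Fin N → ℝ → (Fin n → ℝ) → Fin n → ℝ} (h : ∀ i, Reg (f i))
    (R : ℝ) (hR : 0 ≤ R) :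
    ∃ L : NNReal, ∃ M : ℝ, 0 ≤ M ∧ (∀ i t, LipschitzOnWith L (f i t) (closedBall 0 R)) ∧
      ∀ i t x, ‖x‖ ≤ R → ‖f i t x‖ ≤ M := by
  choose L hL using fun i => bs_lip (h i) R
  choose C hC0 hC using fun i => bs_bound0 (h i)
  refine ⟨∑ i, L i, ∑ i, C i + (∑ i, L i : NNReal) * R, ?_, ?_, ?_⟩
  · have := Finset.sum_nonneg fun i (_ : i ∈ Finset.univ) => hC0 i
    positivity
  · exact fun i t => (hL i t).weaken (Finset.single_le_sum (f := L) (fun _ _ => zero_le) (Finset.mem_univ i))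
  · intro i t x hx
    have h1 := (hL i t).norm_sub_le (mem_closedBall_zero_iff.2 hx)
      (mem_closedBall_zero_iff.2 (by simpa using hR : ‖(0 : Fin n → ℝ)‖ ≤ R))
    have h2 : ‖f i t x‖ ≤ ‖f i t x - f i t 0‖ + ‖f i t 0‖ := norm_le_norm_sub_add _ _
    have h3 := Finset.single_le_sum (f := C) (fun i _ => hC0 i) (Finset.mem_univ i)
    have h4 : (L i : ℝ) ≤ (∑ i, L i : NNReal) := by
      exact_mod_cast Finset.single_le_sum (f := L) (fun _ _ => zero_le) (Finset.mem_univ i)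
    rw [sub_zero] at h1
    have h5 : (L i : ℝ) * ‖x‖ ≤ (∑ i, L i : NNReal) * R := by gcongr
    linarith [hC i t]

end alg

section net
open Set Metric

theorem bs_deriv_quad {n : ℕ} {M : Matrix (Fin n) (Fin n) ℝ} (hM : Mᵀ = M)
    {z : ℝ → Fin n → ℝ} {z' : Fin n → ℝ} {t : ℝ} (hz : HasDerivAt z z' t) :
    HasDerivAt (fun t => z t ⬝ᵥ M *ᵥ z t) (2 * (z t ⬝ᵥ M *ᵥ z')) t := by
  have h1 : HasDerivAt (fun t => M *ᵥ z t) (M *ᵥ z') t :=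
    (LinearMap.toContinuousLinearMap M.mulVecLin).hasFDerivAt.comp_hasDerivAt t hz
  have h2 : HasDerivAt (fun t => ∑ i, z t i * (M *ᵥ z t) i)
      (∑ i, (z' i * (M *ᵥ z t) i + z t i * (M *ᵥ z') i)) t :=
    HasDerivAt.fun_sum fun i _ => ((hasDerivAt_pi.1 hz) i).mul ((hasDerivAt_pi.1 h1) i)
  have e : ∑ i, (z' i * (M *ᵥ z t) i + z t i * (M *ᵥ z') i) = 2 * (z t ⬝ᵥ M *ᵥ z') := by
    rw [Finset.sum_add_distrib]
    have := bs_symm_dot hM z' (z t)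
    simp only [dotProduct] at this ⊢
    rw [this]; ring
  rw [e] at h2
  exact h2

theorem bs_deriv_dot {n : ℕ} {z : ℝ → Fin n → ℝ} {z' : Fin n → ℝ} {t : ℝ}
    (hz : HasDerivAt z z' t) :
    HasDerivAt (fun t => z t ⬝ᵥ z t) (2 * (z t ⬝ᵥ z')) t := by
  simpa using bs_deriv_quad (M := 1) (by simp) hz

theorem bs_avg {N n : ℕ} (hN : 0 < N) (a : Fin N → Fin n → ℝ) (c : ℝ) (h : ∀ i, ‖a i‖ ≤ c) :
    ‖(N : ℝ)⁻¹ • ∑ i, a i‖ ≤ c := by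
  have hN' : (0 : ℝ) < N := by exact_mod_cast hN
  rw [norm_smul, Real.norm_of_nonneg (by positivity), inv_mul_le_iff₀ hN']
  calc ‖∑ i, a i‖ ≤ ∑ _i : Fin N, c := norm_sum_le_of_le _ fun i _ => h i
    _ = _ := by simp

theorem bs_theta {n : ℕ} {Θ : Matrix (Fin n) (Fin n) ℝ} (hΘ : Θ.PosDef) (hs : Θᵀ = Θ) :
    ∃ θ > 0, ∃ m > 0, ∃ θ₂ > 0, ∀ v : Fin n → ℝ, v ⬝ᵥ Θ *ᵥ v ≤ θ * (v ⬝ᵥ v) ∧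
      m * (v ⬝ᵥ v) ≤ v ⬝ᵥ Θ *ᵥ v ∧ (Θ *ᵥ v) ⬝ᵥ (Θ *ᵥ v) ≤ θ₂ * (v ⬝ᵥ v) := by
  obtain ⟨⟨θ, hθ, h1⟩, h2⟩ := bs_quad_bounds (univ : Set (Fin n → ℝ)) isClosed_univ
    (fun _ _ _ => mem_univ _) Θ
  obtain ⟨m, hm, h2⟩ := h2 fun v _ hv => by simpa using hΘ.dotProduct_mulVec_pos hv
  obtain ⟨⟨θ₂, hθ₂, h3⟩, -⟩ := bs_quad_bounds (univ : Set (Fin n → ℝ)) isClosed_univ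
    (fun _ _ _ => mem_univ _) (Θ * Θ)
  refine ⟨θ, hθ, m, hm, θ₂, hθ₂, fun v => ⟨h1 v trivial, h2 v trivial, ?_⟩⟩
  have := h3 v trivial
  rwa [← mulVec_mulVec, bs_symm_dot2 hs] at this

theorem bs_norm_le_of_dot {n : ℕ} (v : Fin n → ℝ) (q : ℝ) (h : v ⬝ᵥ v ≤ q) : ‖v‖ ≤ 1 + q := by
  have := bs_norm_sq_le v
  nlinarith [norm_nonneg v, sq_nonneg (‖v‖ - 1)]

/-- Global bounded solutions of the blended dynamics. -/
theorem bs_s_exists {N n : ℕ} (hN : 0 < N) (t₀ : ℝ)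
    (f : Fin N → ℝ → (Fin n → ℝ) → Fin n → ℝ) (hreg : ∀ i, Reg (f i))
    (Θ : Matrix (Fin n) (Fin n) ℝ) (hΘ : Θ.PosDef) (hsy : Θᵀ = Θ)
    (hcon : ∀ t x y, 2 * ((x - y) ⬝ᵥ Θ *ᵥ ((N : ℝ)⁻¹ • ∑ i, f i t x - (N : ℝ)⁻¹ • ∑ i, f i t y))
      ≤ - ((x - y) ⬝ᵥ (x - y))) (r₀ : ℝ) :
    ∃ Rs ≥ (0 : ℝ), ∀ s₀ : Fin n → ℝ, ‖s₀‖ ≤ r₀ → ∃ s : ℝ → Fin n → ℝ, s t₀ = s₀ ∧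
      (∀ t ≥ t₀, HasDerivAt s ((N : ℝ)⁻¹ • ∑ i, f i t (s t)) t) ∧ ∀ t ≥ t₀, ‖s t‖ ≤ Rs := by
  obtain ⟨θ, hθ, m, hm, θ₂, hθ₂, hq⟩ := bs_theta hΘ hsy
  obtain ⟨-, C, hC0, -, hC⟩ := bs_unif hreg 0 le_rfl
  set b : ℝ := 2 * (θ₂ * (n * C ^ 2)) with hb
  have hb0 : 0 ≤ b := by positivity
  set ρ : ℝ := 2 * θ * b with hρ
  have hρ0 : 0 ≤ ρ := by positivity
  set RV : ℝ := θ * (n * r₀ ^ 2) + ρ + 1 with hRV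
  have hRV0 : 0 < RV := by positivity
  set Rs : ℝ := 1 + RV / m with hRs
  have hRs0 : 0 ≤ Rs := by positivity
  obtain ⟨L, M, hM0, hL, hM⟩ := bs_unif hreg Rs hRs0
  refine ⟨Rs, hRs0, fun s₀ hs₀ => ?_⟩
  obtain ⟨s, s', hs0, hder, hs'⟩ := bs_trunc (fun t x => (N : ℝ)⁻¹ • ∑ i, f i t x) L Rs M
    (bs_clamp1 Rs hRs0)
    (fun t => LipschitzOnWith.of_dist_le_mul fun x hx y hy => by
      rw [dist_eq_norm, ← smul_sub, ← Finset.sum_sub_distrib]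
      refine bs_avg hN _ _ fun i => ?_
      rw [← dist_eq_norm]
      exact (hL i t).dist_le_mul x hx y hy)
    (fun x => by
      have : ∀ i, Continuous fun t => f i t x := fun i =>
        (hreg i).1.comp (continuous_id.prodMk continuous_const)
      exact Continuous.const_smul (continuous_finsetSum _ fun i _ => this i) ((N : ℝ)⁻¹))
    (fun t x hx => bs_avg hN _ _ fun i => hM i t x hx) t₀ s₀
  have hreg2 : ∀ t, s t ⬝ᵥ Θ *ᵥ s t ≤ RV → ‖s t‖ ≤ Rs := by
    intro t ht
    refine bs_norm_le_of_dot _ _ ?_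
    rw [le_div_iff₀ hm]
    linarith [(hq (s t)).2.1]
  have hly := bs_lyap (fun t => s t ⬝ᵥ Θ *ᵥ s t) (fun t => 2 * (s t ⬝ᵥ Θ *ᵥ s' t)) t₀ RV
    (1 / (2 * θ)) ρ (by positivity) (by rw [hRV]; have : 0 ≤ θ * (n * r₀ ^ 2) := by positivity
                                        linarith)
    (fun t _ => bs_deriv_quad hsy (hder t))
    (by
      have h1 := (hq (s t₀)).1
      have h2 := bs_dot_le_norm (s t₀)
      rw [hs0] at h1 h2
      simp only [hs0]
      have h3 : (n : ℝ) * ‖s₀‖ ^ 2 ≤ n * r₀ ^ 2 := by gcongr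
      have h4 : θ * (s₀ ⬝ᵥ s₀) ≤ θ * (n * r₀ ^ 2) := by gcongr; linarith
      linarith)
    (fun t _ hWt => by
      have hn := hreg2 t hWt
      simp only [hs' t hn]
      have h1 := hcon t (s t) 0
      set F0 := (N : ℝ)⁻¹ • ∑ i, f i t 0 with hF0
      rw [sub_zero, mulVec_sub, dotProduct_sub] at h1
      have h2 : s t ⬝ᵥ Θ *ᵥ F0 = s t ⬝ᵥ Θ *ᵥ F0 := rfl
      have h3 := bs_young (s t) (Θ *ᵥ F0) (1 / 2) (by norm_num)
      have h4 := (hq F0).2.2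
      have h5 := bs_dot_le_norm F0
      have h6 : ‖F0‖ ≤ C := bs_avg hN _ _ fun i => hC i t 0 (by simp)
      have h7 : (n : ℝ) * ‖F0‖ ^ 2 ≤ n * C ^ 2 := by gcongr
      have h8 : θ₂ * (F0 ⬝ᵥ F0) ≤ θ₂ * (n * C ^ 2) := by gcongr; linarith
      have h9 := (hq (s t)).1
      have h10 : -(1 / (2 * θ)) * (s t ⬝ᵥ Θ *ᵥ s t - ρ) = - (s t ⬝ᵥ Θ *ᵥ s t) / (2 * θ) + b := by
        rw [hρ]; field_simp; ring
      have h11 : (s t ⬝ᵥ Θ *ᵥ s t) / (2 * θ) ≤ (s t ⬝ᵥ s t) / 2 := by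
        rw [div_le_iff₀ (by positivity)]; linarith
      rw [h10, neg_div]
      have h12 : (Θ *ᵥ F0) ⬝ᵥ (Θ *ᵥ F0) / (1 / 2) = 2 * ((Θ *ᵥ F0) ⬝ᵥ (Θ *ᵥ F0)) := by ring
      rw [h12] at h3
      linarith)
  refine ⟨s, hs0, fun t ht => ?_, fun t ht => hreg2 t (hly.1 t ht)⟩
  have := hder t
  rwa [hs' t (hreg2 t (hly.1 t ht))] at this

theorem bs_lap {N n : ℕ} (α : Fin N → Fin N → ℝ) (hpsd : (lapMat α).PosSemidef)
    (hconn : LinearMap.ker (lapMat α).mulVecLin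
      = Submodule.span ℝ {(fun _ => 1 : Fin N → ℝ)}) (hN : 0 < N) :
    ∃ l > (0 : ℝ), ∀ e : Fin N → Fin n → ℝ, ∑ i, e i = 0 →
      ∑ i, e i ⬝ᵥ ∑ j, α i j • (e j - e i) ≤ - l * ∑ i, e i ⬝ᵥ e i := by
  obtain ⟨-, h⟩ := bs_quad_bounds {v : Fin N → ℝ | ∑ i, v i = 0}
    (isClosed_eq (continuous_finsetSum _ fun i _ => continuous_apply i) continuous_const)
    (fun c v hv => by
      have hv' : ∑ i, v i = 0 := hv
      show ∑ i, c * v i = 0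
      rw [← Finset.mul_sum, hv', mul_zero]) (lapMat α)
  obtain ⟨l, hl, hb⟩ := h (fun v hv hv0 => by
    have hv' : ∑ i, v i = 0 := hv
    have h0 : 0 ≤ v ⬝ᵥ lapMat α *ᵥ v := by simpa using hpsd.dotProduct_mulVec_nonneg v
    refine lt_of_le_of_ne h0 fun heq => hv0 ?_
    have h1 := (hpsd.dotProduct_mulVec_zero_iff v).1 (by simpa using heq.symm)
    have h2 : v ∈ LinearMap.ker (lapMat α).mulVecLin := by simpa using h1
    rw [hconn, Submodule.mem_span_singleton] at h2
    obtain ⟨a, rfl⟩ := h2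
    have : (N : ℝ) * a = 0 := by simpa using hv'
    have hN' : (N : ℝ) ≠ 0 := by exact_mod_cast hN.ne'
    have ha : a = 0 := by simpa [hN'] using this
    simp [ha])
  refine ⟨l, hl, fun e he => ?_⟩
  have hco : ∀ c : Fin n, ∑ i, e i c * ∑ j, α i j * (e j c - e i c) ≤ - l * ∑ i, e i c * e i c := by
    intro c
    have h1 := hb (fun i => e i c) (by
      show ∑ i, e i c = 0
      rw [← Finset.sum_apply, he]; rfl)
    have h2 : (fun i => e i c) ⬝ᵥ lapMat α *ᵥ (fun i => e i c)
        = - ∑ i, e i c * ∑ j, α i j * (e j c - e i c) := by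
      simp only [dotProduct, ← Finset.sum_neg_distrib]
      refine Finset.sum_congr rfl fun i _ => ?_
      rw [← mul_neg]
      congr 1
      simp only [mulVec, dotProduct, lapMat, of_apply, sub_mul, ite_mul, zero_mul,
        Finset.sum_sub_distrib, Finset.sum_ite_eq, Finset.mem_univ, if_true, mul_sub, Finset.sum_mul]
      ring
    rw [h2] at h1
    simp only [dotProduct] at h1
    linarith
  calc ∑ i, e i ⬝ᵥ ∑ j, α i j • (e j - e i)
      = ∑ c, ∑ i, e i c * ∑ j, α i j * (e j c - e i c) := by
        rw [Finset.sum_comm]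
        simp [dotProduct, Finset.sum_apply]
    _ ≤ ∑ c, - l * ∑ i, e i c * e i c := Finset.sum_le_sum fun c _ => hco c
    _ = _ := by
        rw [← Finset.mul_sum, Finset.sum_comm]
        rfl

/-- The static dissipation inequality. -/
theorem bs_static {N n : ℕ} (hN : 0 < N) (α : Fin N → Fin N → ℝ) (hsym : ∀ i j, α i j = α j i)
    (Θ : Matrix (Fin n) (Fin n) ℝ) (θ₂ l k L M : ℝ) (hθ₂ : 0 < θ₂)
    (hq : ∀ v : Fin n → ℝ, (Θ *ᵥ v) ⬝ᵥ (Θ *ᵥ v) ≤ θ₂ * (v ⬝ᵥ v))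
    (hl : 0 < l) (hk : 0 < k) (hL : 0 ≤ L)
    (hlap : ∀ e : Fin N → Fin n → ℝ, ∑ i, e i = 0 →
      ∑ i, e i ⬝ᵥ ∑ j, α i j • (e j - e i) ≤ - l * ∑ i, e i ⬝ᵥ e i)
    (hkl : 2 * (θ₂ * (n * L ^ 2)) + 1 ≤ k * l)
    (x : Fin N → Fin n → ℝ) (xb z Fs : Fin n → ℝ) (hxb : xb = (N : ℝ)⁻¹ • ∑ i, x i)
    (fx fb xd : Fin N → Fin n → ℝ)
    (hxd : ∀ i, xd i = fx i + k • ∑ j, α i j • (x j - x i))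
    (hcon : 2 * (z ⬝ᵥ Θ *ᵥ ((N : ℝ)⁻¹ • ∑ i, fb i - Fs)) ≤ - (z ⬝ᵥ z))
    (hlip : ∀ i, ‖fx i - fb i‖ ≤ L * ‖x i - xb‖) (hM : ∀ i, ‖fx i‖ ≤ M) :
    2 * (z ⬝ᵥ Θ *ᵥ ((N : ℝ)⁻¹ • ∑ i, xd i - Fs)) +
      ∑ i, 2 * ((x i - xb) ⬝ᵥ (xd i - (N : ℝ)⁻¹ • ∑ j, xd j)) ≤
    - (z ⬝ᵥ z) / 2 - ∑ i, (x i - xb) ⬝ᵥ (x i - xb) + N * (n * M ^ 2) / (k * l) := by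
  have hN' : (0 : ℝ) < N := by exact_mod_cast hN
  have hkl0 : 0 < k * l := by positivity
  set e : Fin N → Fin n → ℝ := fun i => x i - xb with he
  set E : ℝ := ∑ i, e i ⬝ᵥ e i with hE
  have hE0 : 0 ≤ E := Finset.sum_nonneg fun i _ => bs_dot_nonneg _
  have hee : ∀ i, x i - xb = e i := fun i => rfl
  simp only [hee] at hlip ⊢
  have hes : ∑ i, e i = 0 := by
    simp only [he, Finset.sum_sub_distrib, Finset.sum_const, Finset.card_univ, Fintype.card_fin]
    rw [hxb, ← Nat.cast_smul_eq_nsmul ℝ, smul_smul, mul_inv_cancel₀ hN'.ne', one_smul, sub_self]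
  -- coupling terms cancel in the average
  have hcancel : ∑ i, ∑ j, α i j • (x j - x i) = 0 := by
    have h1 : ∑ i, ∑ j, α i j • (x j - x i) = - ∑ i, ∑ j, α i j • (x j - x i) := by
      conv_lhs => rw [Finset.sum_comm]
      rw [← Finset.sum_neg_distrib]
      refine Finset.sum_congr rfl fun i _ => ?_
      rw [← Finset.sum_neg_distrib]
      refine Finset.sum_congr rfl fun j _ => ?_
      rw [hsym j i, ← smul_neg, neg_sub]
    exact self_eq_neg.1 h1
  have hsum : ∑ i, xd i = ∑ i, fx i := by
    simp only [hxd, Finset.sum_add_distrib, ← Finset.smul_sum, hcancel, smul_zero, add_zero]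
  -- first part
  set w : Fin n → ℝ := (N : ℝ)⁻¹ • ∑ i, (fx i - fb i) with hw
  have hsplit : (N : ℝ)⁻¹ • ∑ i, xd i - Fs = ((N : ℝ)⁻¹ • ∑ i, fb i - Fs) + w := by
    rw [hsum, hw, Finset.sum_sub_distrib, smul_sub]; abel
  have hw1 : ‖w‖ ≤ L * Real.sqrt E := by
    refine bs_avg hN _ _ fun i => (hlip i).trans ?_
    gcongr
    refine Real.le_sqrt_of_sq_le ((bs_norm_sq_le (e i)).trans ?_)
    exact Finset.single_le_sum (f := fun i => e i ⬝ᵥ e i) (fun i _ => bs_dot_nonneg _)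
      (Finset.mem_univ i)
  have hw2 : w ⬝ᵥ w ≤ n * L ^ 2 * E := by
    refine (bs_dot_le_norm w).trans ?_
    have : ‖w‖ ^ 2 ≤ L ^ 2 * E := by
      calc ‖w‖ ^ 2 ≤ (L * Real.sqrt E) ^ 2 := by gcongr
        _ = L ^ 2 * E := by rw [mul_pow, Real.sq_sqrt hE0]
    rw [mul_assoc]; gcongr
  have hzw : 2 * (z ⬝ᵥ Θ *ᵥ w) ≤ z ⬝ᵥ z / 2 + 2 * (θ₂ * (n * L ^ 2)) * E := by
    have h1 := bs_young z (Θ *ᵥ w) (1 / 2) (by norm_num)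
    have h2 := hq w
    have h3 : θ₂ * (w ⬝ᵥ w) ≤ θ₂ * (n * L ^ 2 * E) := by gcongr
    have h4 : (Θ *ᵥ w) ⬝ᵥ (Θ *ᵥ w) / (1 / 2) = 2 * ((Θ *ᵥ w) ⬝ᵥ (Θ *ᵥ w)) := by ring
    rw [h4] at h1
    linarith
  have hA : 2 * (z ⬝ᵥ Θ *ᵥ ((N : ℝ)⁻¹ • ∑ i, xd i - Fs)) ≤
      - (z ⬝ᵥ z) / 2 + 2 * (θ₂ * (n * L ^ 2)) * E := by
    rw [hsplit, mulVec_add, dotProduct_add]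
    linarith
  -- second part
  have hB1 : ∑ i, 2 * (e i ⬝ᵥ (xd i - (N : ℝ)⁻¹ • ∑ j, xd j)) =
      ∑ i, 2 * (e i ⬝ᵥ fx i) + 2 * k * ∑ i, e i ⬝ᵥ ∑ j, α i j • (e j - e i) := by
    have h1 : ∀ i, 2 * (e i ⬝ᵥ (xd i - (N : ℝ)⁻¹ • ∑ j, xd j)) =
        2 * (e i ⬝ᵥ fx i) + 2 * k * (e i ⬝ᵥ ∑ j, α i j • (e j - e i))
          - 2 * (e i ⬝ᵥ ((N : ℝ)⁻¹ • ∑ j, xd j)) := by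
      intro i
      have : ∀ j, e j - e i = x j - x i := fun j => by simp [he]
      simp only [this, dotProduct_sub, hxd i, dotProduct_add, dotProduct_smul, smul_eq_mul]
      ring
    simp only [h1, Finset.sum_sub_distrib, Finset.sum_add_distrib, ← Finset.mul_sum]
    have h2 : ∑ i, e i ⬝ᵥ ((N : ℝ)⁻¹ • ∑ j, xd j) = 0 := by
      rw [← sum_dotProduct, hes, zero_dotProduct]
    rw [h2]; ring
  have hB2 : ∑ i, 2 * (e i ⬝ᵥ fx i) ≤ k * l * E + N * (n * M ^ 2) / (k * l) := by
    calc ∑ i, 2 * (e i ⬝ᵥ fx i)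
        ≤ ∑ i, (k * l * (e i ⬝ᵥ e i) + (n * M ^ 2) / (k * l)) := by
          refine Finset.sum_le_sum fun i _ => (bs_young _ _ _ hkl0).trans ?_
          have h1 : fx i ⬝ᵥ fx i ≤ n * M ^ 2 := by
            refine (bs_dot_le_norm _).trans ?_
            have := hM i
            gcongr
          gcongr
      _ = _ := by
          rw [Finset.sum_add_distrib, ← Finset.mul_sum]
          simp [mul_div_assoc, hE]
  have hB3 := hlap e hes
  have hB4 : 2 * k * ∑ i, e i ⬝ᵥ ∑ j, α i j • (e j - e i) ≤ 2 * k * (- l * E) := by gcongr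
  rw [hB1]
  nlinarith

end net

section net2
open Set Metric

theorem bs_net_exists {N n : ℕ} (α : Fin N → Fin N → ℝ) (k : ℝ)
    (f : Fin N → ℝ → (Fin n → ℝ) → Fin n → ℝ) (hreg : ∀ i, Reg (f i)) (R : ℝ) (hR : 0 ≤ R)
    (t₀ : ℝ) (X₀ : Fin N → Fin n → ℝ) :
    ∃ x x' : ℝ → Fin N → Fin n → ℝ, x t₀ = X₀ ∧ (∀ t, HasDerivAt x (x' t) t) ∧
      ∀ t, ‖x t‖ ≤ R → ∀ i, x' t i = f i t (x t i) + k • ∑ j, α i j • (x t j - x t i) := by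
  obtain ⟨L, M, hM0, hL, hM⟩ := bs_unif hreg R hR
  set S : ℝ := ∑ i, ∑ j, |α i j| with hS
  have hSi : ∀ i, ∑ j, |α i j| ≤ S := fun i =>
    Finset.single_le_sum (f := fun i => ∑ j, |α i j|)
      (fun i _ => Finset.sum_nonneg fun j _ => abs_nonneg _) (Finset.mem_univ i)
  have hS0 : 0 ≤ S := Finset.sum_nonneg fun i _ => Finset.sum_nonneg fun j _ => abs_nonneg _
  have hlin : ∀ (x : Fin N → Fin n → ℝ) (i : Fin N),
      ‖k • ∑ j, α i j • (x j - x i)‖ ≤ |k| * (S * (2 * ‖x‖)) := by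
    intro x i
    rw [norm_smul, Real.norm_eq_abs]
    gcongr
    calc ‖∑ j, α i j • (x j - x i)‖ ≤ ∑ j, |α i j| * (2 * ‖x‖) := by
          refine norm_sum_le_of_le _ fun j _ => ?_
          rw [norm_smul, Real.norm_eq_abs]
          gcongr
          have h1 := norm_sub_le (x j) (x i)
          have h2 := norm_le_pi_norm x j
          have h3 := norm_le_pi_norm x i
          linarith
      _ = (∑ j, |α i j|) * (2 * ‖x‖) := by rw [Finset.sum_mul]
      _ ≤ _ := by have := hSi i; gcongr
  let Lk : NNReal := ⟨|k| * (S * 2), by positivity⟩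
  obtain ⟨x, x', h0, hd, hx'⟩ := bs_trunc
    (fun t (X : Fin N → Fin n → ℝ) => fun i => f i t (X i) + k • ∑ j, α i j • (X j - X i))
    (L + Lk) R (M + |k| * (S * (2 * R))) (bs_clamp2 R hR)
    (fun t => LipschitzOnWith.of_dist_le_mul fun x hx y hy => by
      rw [mem_closedBall_zero_iff] at hx hy
      rw [dist_pi_le_iff (by positivity)]
      intro i
      have h1 := (hL i t).dist_le_mul (x i)
        (mem_closedBall_zero_iff.2 ((norm_le_pi_norm x i).trans hx)) (y i)
        (mem_closedBall_zero_iff.2 ((norm_le_pi_norm y i).trans hy))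
      have h2 := dist_le_pi_dist x y i
      have h3 : (L : ℝ) * dist (x i) (y i) ≤ L * dist x y := by gcongr
      have h4 := hlin (x - y) i
      rw [← dist_eq_norm] at h4
      have h5 : k • ∑ j, α i j • ((x - y) j - (x - y) i) =
          k • ∑ j, α i j • (x j - x i) - k • ∑ j, α i j • (y j - y i) := by
        rw [← smul_sub, ← Finset.sum_sub_distrib]
        congr 1
        refine Finset.sum_congr rfl fun j _ => ?_
        rw [← smul_sub]
        congr 1
        simp only [Pi.sub_apply]
        abel
      rw [h5, ← dist_eq_norm] at h4
      refine (dist_add_add_le _ _ _ _).trans ?_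
      have h6 : ((L + Lk : NNReal) : ℝ) = L + |k| * (S * 2) := by
        rw [NNReal.coe_add]; rfl
      rw [h6]
      nlinarith)
    (fun X => continuous_pi fun i => by
      have : Continuous fun t => f i t (X i) :=
        (hreg i).1.comp (continuous_id.prodMk continuous_const)
      exact this.add continuous_const)
    (fun t X hX => by
      rw [pi_norm_le_iff_of_nonneg (by positivity)]
      intro i
      refine (norm_add_le _ _).trans ?_
      have h1 := hM i t (X i) ((norm_le_pi_norm X i).trans hX)
      have h2 := hlin X i
      have h3 : |k| * (S * (2 * ‖X‖)) ≤ |k| * (S * (2 * R)) := by gcongr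
      linarith) t₀ X₀
  exact ⟨x, x', h0, hd, fun t ht i => by rw [hx' t ht]⟩

theorem bs_split {n : ℕ} (a b c : Fin n → ℝ) : ∑ j, (a - c) j ^ 2 ≤
    2 * ((a - b) ⬝ᵥ (a - b)) + 2 * ((b - c) ⬝ᵥ (b - c)) := by
  simp only [dotProduct, Finset.mul_sum, ← Finset.sum_add_distrib]
  refine Finset.sum_le_sum fun j _ => ?_
  simp only [Pi.sub_apply]
  nlinarith [sq_nonneg ((a j - b j) - (b j - c j))]

end net2

set_option maxHeartbeats 1000000 in
theorem stmt0
    {N n : ℕ} (hN : 2 ≤ N) (t₀ : ℝ)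
    (α : Fin N → Fin N → ℝ)
    (hsym : ∀ i j, α i j = α j i) (hnn : ∀ i j, 0 ≤ α i j) (hdiag : ∀ i, α i i = 0)
    (hpsd : (lapMat α).PosSemidef)
    (hconn : LinearMap.ker (lapMat α).mulVecLin
      = Submodule.span ℝ {(fun _ => 1 : Fin N → ℝ)})
    (f : Fin N → ℝ → (Fin n → ℝ) → Fin n → ℝ)
    (hreg : ∀ i, Reg (f i))
    (hcontr : Contractive (fun t s => (N : ℝ)⁻¹ • ∑ i, f i t s))
    (K : Set (Fin N → Fin n → ℝ)) (hK : IsCompact K)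
    (η : ℝ) (hη : 0 < η) :
    ∃ kstar > (0:ℝ), ∀ k > kstar, ∀ X₀ ∈ K,
      ∃ (x : Fin N → ℝ → Fin n → ℝ) (s : ℝ → Fin n → ℝ),
        (∀ i, x i t₀ = X₀ i) ∧
        (∀ i, ∀ t ≥ t₀, HasDerivAt (x i)
          (f i t (x i t) + k • ∑ j, α i j • (x j t - x i t)) t) ∧
        s t₀ = (N : ℝ)⁻¹ • ∑ i, X₀ i ∧
        (∀ t ≥ t₀, HasDerivAt s ((N : ℝ)⁻¹ • ∑ i, f i t (s t)) t) ∧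
        ∀ i, LimsupLE (fun t => eunorm (x i t - s t)) η := by
  have hN0 : 0 < N := by omega
  have hN' : (0 : ℝ) < N := by exact_mod_cast hN0
  obtain ⟨Θ, hΘ, hsy, hcon⟩ := bs_contr hcontr
  obtain ⟨θ, hθ, m, hm, θ₂, hθ₂, hq⟩ := bs_theta hΘ hsy
  obtain ⟨l, hl, hlap⟩ := bs_lap (n := n) α hpsd hconn hN0
  obtain ⟨r, hr0, hr⟩ : ∃ r : ℝ, 0 ≤ r ∧ ∀ X ∈ K, ‖X‖ ≤ r := by
    obtain ⟨r, hr⟩ := hK.isBounded.exists_norm_le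
    exact ⟨max r 0, le_max_right _ _, fun X hX => (hr X hX).trans (le_max_left _ _)⟩
  obtain ⟨Rs, hRs0, hsol⟩ := bs_s_exists hN0 t₀ f hreg Θ hΘ hsy hcon r
  obtain ⟨D, hD⟩ : ∃ D : ℝ, D = 2 + 2 / m := ⟨_, rfl⟩
  have hD0 : 0 < D := by rw [hD]; positivity
  obtain ⟨ρ, hρ⟩ : ∃ ρ : ℝ, ρ = η ^ 2 / D := ⟨_, rfl⟩
  have hρ0 : 0 < ρ := by rw [hρ]; positivity
  obtain ⟨c, hc⟩ : ∃ c : ℝ, c = min (1 / (2 * θ)) 1 := ⟨_, rfl⟩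
  have hc0 : 0 < c := by rw [hc]; positivity
  have hc1 : c ≤ 1 := by rw [hc]; exact min_le_right _ _
  have hc2 : c * θ ≤ 1 / 2 := by
    have : c ≤ 1 / (2 * θ) := by rw [hc]; exact min_le_left _ _
    rw [le_div_iff₀ (by positivity)] at this
    linarith
  obtain ⟨R₀, hR₀⟩ : ∃ R₀ : ℝ, R₀ = N * (n * (2 * r) ^ 2) + ρ + 1 := ⟨_, rfl⟩
  have hnn0 : (0 : ℝ) ≤ N * (n * (2 * r) ^ 2) := by positivity
  have hR₀0 : 0 < R₀ := by rw [hR₀]; positivity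
  obtain ⟨R, hRdef⟩ : ∃ R : ℝ, R = Rs + (1 + R₀ / m) + (1 + R₀) := ⟨_, rfl⟩
  have hR₀m : 0 < R₀ / m := by positivity
  have hR0 : 0 ≤ R := by rw [hRdef]; positivity
  obtain ⟨L, M, hM0, hL, hM⟩ := bs_unif hreg R hR0
  obtain ⟨A, hA⟩ : ∃ A : ℝ, A = 2 * (θ₂ * (n * (L : ℝ) ^ 2)) := ⟨_, rfl⟩
  have hA0 : 0 ≤ A := by rw [hA]; positivity
  obtain ⟨B, hB⟩ : ∃ B : ℝ, B = N * (n * M ^ 2) := ⟨_, rfl⟩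
  have hB0 : 0 ≤ B := by rw [hB]; positivity
  refine ⟨(A + 1) / l + B / (l * c * ρ) + 1, by positivity, fun k hk X₀ hX₀ => ?_⟩
  have hp1 : 0 ≤ (A + 1) / l := by positivity
  have hp2 : 0 ≤ B / (l * c * ρ) := by positivity
  have hk0 : 0 < k := by linarith
  have hkl : A + 1 ≤ k * l := by
    rw [← div_le_iff₀ hl]; linarith
  have hkB : B / (k * l) ≤ c * ρ := by
    rw [div_le_iff₀ (by positivity)]
    have : B / (l * c * ρ) ≤ k := by linarith
    rw [div_le_iff₀ (by positivity)] at this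
    linarith
  have hX₀i : ∀ i, ‖X₀ i‖ ≤ r := fun i => (norm_le_pi_norm X₀ i).trans (hr X₀ hX₀)
  have hav : ‖(N : ℝ)⁻¹ • ∑ i, X₀ i‖ ≤ r := bs_avg hN0 _ _ hX₀i
  obtain ⟨s, hs0, hsd, hsb⟩ := hsol _ hav
  obtain ⟨x, x', hx0, hxd, hx'⟩ := bs_net_exists α k f hreg R hR0 t₀ X₀
  have hxdi : ∀ i t, HasDerivAt (fun t => x t i) (x' t i) t := fun i t => hasDerivAt_pi.1 (hxd t) i
  let xb : ℝ → Fin n → ℝ := fun t => (N : ℝ)⁻¹ • ∑ i, x t i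
  have hxb : ∀ t, HasDerivAt xb ((N : ℝ)⁻¹ • ∑ i, x' t i) t := fun t =>
    HasDerivAt.const_smul ((N : ℝ)⁻¹) (HasDerivAt.fun_sum fun i _ => hxdi i t)
  let z : ℝ → Fin n → ℝ := fun t => xb t - s t
  let W : ℝ → ℝ := fun t => z t ⬝ᵥ Θ *ᵥ z t + ∑ i, (x t i - xb t) ⬝ᵥ (x t i - xb t)
  let W' : ℝ → ℝ := fun t =>
    2 * (z t ⬝ᵥ Θ *ᵥ ((N : ℝ)⁻¹ • ∑ i, x' t i - (N : ℝ)⁻¹ • ∑ i, f i t (s t))) +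
      ∑ i, 2 * ((x t i - xb t) ⬝ᵥ (x' t i - (N : ℝ)⁻¹ • ∑ j, x' t j))
  have hWd : ∀ t ≥ t₀, HasDerivAt W (W' t) t := fun t ht =>
    (bs_deriv_quad hsy ((hxb t).sub (hsd t ht))).add
      (HasDerivAt.fun_sum fun i _ => bs_deriv_dot ((hxdi i t).sub (hxb t)))
  have hEi : ∀ t i, (x t i - xb t) ⬝ᵥ (x t i - xb t)
      ≤ ∑ i, (x t i - xb t) ⬝ᵥ (x t i - xb t) := fun t i =>
    Finset.single_le_sum (f := fun i => (x t i - xb t) ⬝ᵥ (x t i - xb t))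
      (fun i _ => bs_dot_nonneg _) (Finset.mem_univ i)
  have hE0 : ∀ t, 0 ≤ ∑ i, (x t i - xb t) ⬝ᵥ (x t i - xb t) := fun t =>
    Finset.sum_nonneg fun i _ => bs_dot_nonneg _
  have hWz : ∀ t, m * (z t ⬝ᵥ z t) ≤ W t := fun t => by
    have h1 := (hq (z t)).2.1
    have h2 := hE0 t
    simp only [W]
    linarith
  have hWe : ∀ t i, (x t i - xb t) ⬝ᵥ (x t i - xb t) ≤ W t := fun t i => by
    have h1 := (hq (z t)).2.1
    have h2 := hEi t i
    have h3 : 0 ≤ m * (z t ⬝ᵥ z t) := mul_nonneg hm.le (bs_dot_nonneg _)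
    simp only [W]
    linarith
  have hregion : ∀ t ≥ t₀, W t ≤ R₀ → ‖xb t‖ ≤ R ∧ ‖x t‖ ≤ R := by
    intro t ht hWt
    have h1 : ‖z t‖ ≤ 1 + R₀ / m := by
      refine bs_norm_le_of_dot _ _ ?_
      rw [le_div_iff₀ hm]
      linarith [hWz t]
    have h2 : ‖xb t‖ ≤ Rs + (1 + R₀ / m) := by
      have e : xb t = s t + z t := by simp [z]
      rw [e]
      exact (norm_add_le _ _).trans (add_le_add (hsb t ht) h1)
    refine ⟨by rw [hRdef]; linarith, ?_⟩
    rw [pi_norm_le_iff_of_nonneg hR0]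
    intro i
    have h3 : ‖x t i - xb t‖ ≤ 1 + R₀ := bs_norm_le_of_dot _ _ ((hWe t i).trans hWt)
    have e : x t i = xb t + (x t i - xb t) := by abel
    rw [e, hRdef]
    exact (norm_add_le _ _).trans (add_le_add h2 h3)
  have hW0 : W t₀ ≤ R₀ := by
    have e1 : xb t₀ = (N : ℝ)⁻¹ • ∑ i, X₀ i := by simp [xb, hx0]
    have e2 : z t₀ = 0 := by simp only [z, e1, hs0, sub_self]
    simp only [W, e2, zero_dotProduct, zero_add]
    have : ∑ i, (x t₀ i - xb t₀) ⬝ᵥ (x t₀ i - xb t₀) ≤ ∑ _i : Fin N, (n * (2 * r) ^ 2 : ℝ) := by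
      refine Finset.sum_le_sum fun i _ => (bs_dot_le_norm _).trans ?_
      have : ‖x t₀ i - xb t₀‖ ≤ 2 * r := by
        rw [e1, hx0]
        exact (norm_sub_le _ _).trans (by linarith [hX₀i i])
      gcongr
    rw [Finset.sum_const, Finset.card_univ, Fintype.card_fin, nsmul_eq_mul] at this
    rw [hR₀]
    linarith
  have hdiss : ∀ t ≥ t₀, W t ≤ R₀ → W' t ≤ - c * (W t - ρ) := by
    intro t ht hWt
    obtain ⟨hb1, hb2⟩ := hregion t ht hWt
    have hst := bs_static hN0 α hsym Θ θ₂ l k L M hθ₂ (fun v => (hq v).2.2) hl hk0 L.2 hlap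
      (by rw [← hA]; exact hkl) (x t) (xb t) (z t) ((N : ℝ)⁻¹ • ∑ i, f i t (s t)) rfl
      (fun i => f i t (x t i)) (fun i => f i t (xb t)) (x' t) (hx' t hb2)
      (hcon t (xb t) (s t))
      (fun i => (hL i t).norm_sub_le
        (mem_closedBall_zero_iff.2 ((norm_le_pi_norm (x t) i).trans hb2))
        (mem_closedBall_zero_iff.2 hb1))
      (fun i => hM i t _ ((norm_le_pi_norm (x t) i).trans hb2))
    rw [← hB] at hst
    have h1 : c * (z t ⬝ᵥ Θ *ᵥ z t) ≤ (z t ⬝ᵥ z t) / 2 := by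
      have h2 := (hq (z t)).1
      have h3 : c * (z t ⬝ᵥ Θ *ᵥ z t) ≤ c * (θ * (z t ⬝ᵥ z t)) := by gcongr
      have h4 : c * θ * (z t ⬝ᵥ z t) ≤ 1 / 2 * (z t ⬝ᵥ z t) :=
        mul_le_mul_of_nonneg_right hc2 (bs_dot_nonneg _)
      linarith
    have h5 := mul_le_mul_of_nonneg_right hc1 (hE0 t)
    simp only [W, W']
    linarith
  obtain ⟨hinv, hlim⟩ := bs_lyap W W' t₀ R₀ c ρ hc0 (by rw [hR₀]; linarith) hWd hW0 hdiss
  refine ⟨fun i t => x t i, s, fun i => by simp only [hx0], fun i t ht => ?_, hs0, hsd, ?_⟩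
  · have := hxdi i t
    rwa [hx' t (hregion t ht (hinv t ht)).2 i] at this
  intro i ε hε
  have htend : Tendsto (fun t : ℝ => D * ((R₀ - ρ) * Real.exp (- c * (t - t₀)))) atTop
      (nhds (D * ((R₀ - ρ) * 0))) := by
    refine ((Real.tendsto_exp_atBot.comp ?_).const_mul _).const_mul _
    have : Tendsto (fun t : ℝ => t - t₀) atTop atTop := tendsto_atTop_add_const_right _ _ tendsto_id
    exact this.const_mul_atTop_of_neg (by linarith)
  rw [mul_zero, mul_zero] at htend
  obtain ⟨T, hT⟩ := eventually_atTop.1 (htend.eventually (ge_mem_nhds (show 0 < ε ^ 2 by positivity)))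
  refine ⟨max T t₀, fun t ht => ?_⟩
  have ht1 : T ≤ t := (le_max_left _ _).trans ht
  have ht2 : t ≥ t₀ := (le_max_right _ _).trans ht
  have h1 := hT t ht1
  have h2 := hlim t ht2
  have h3 : D * W t ≤ η ^ 2 + ε ^ 2 := by
    have h4 : D * W t ≤ D * (ρ + (R₀ - ρ) * Real.exp (- c * (t - t₀))) := by gcongr
    have h5 : D * ρ = η ^ 2 := by rw [hρ]; field_simp
    linarith
  unfold eunorm
  refine Real.sqrt_le_iff.2 ⟨by positivity, ?_⟩
  have h6 : ∑ j, (x t i - s t) j ^ 2 ≤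
      2 * ((x t i - xb t) ⬝ᵥ (x t i - xb t)) + 2 * (z t ⬝ᵥ z t) := by
    exact bs_split (x t i) (xb t) (s t)
  have h7 : z t ⬝ᵥ z t ≤ W t / m := by
    rw [le_div_iff₀ hm]; linarith [hWz t]
  have h8 : D * W t = 2 * W t + 2 * (W t / m) := by rw [hD]; ring
  have h9 := hWe t i
  have h10 := mul_pos hη hε
  have h11 : (η + ε) ^ 2 = η ^ 2 + 2 * (η * ε) + ε ^ 2 := by ring
  rw [h11]
  linarith
end

section
/- Consider the network ẋ_i = f_i(t, x_i) + k·Σ_{j∈N_i} α_{ij}(x_j − x_i) ∈ ℝ^n, i = 1,…,N, over an undirected connected weighted graph, with blended dynamics ṡ = (1/N)·Σ_{i=1}^N f_i(t, s). Assume there is a nonempty compact set 𝒜_b ⊂ ℝ^n that is uniformly asymptotically stable for the blended dynamics, with an open set 𝒟_b ⊇ 𝒜_b contained in its domain of attraction. Define 𝒟_x := {1_N ⊗ s + w : s ∈ 𝒟_b, w ∈ ℝ^{nN} with (1_Nᵀ ⊗ I_n)w = 0}. Then for every compact set K ⊂ 𝒟_x and every η > 0 there exists k* > 0 such that for every k >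 k* and every initial condition (x_1(t₀),…,x_N(t₀)) ∈ K, the solution of the network exists for all t ≥ t₀ and satisfies limsup_{t→∞} ‖x_i(t) − x_j(t)‖ ≤ η and limsup_{t→∞} dist(x_i(t), 𝒜_b) ≤ η for all i, j ∈ {1,…,N}. -/
open Filter Matrix

/-- Euclidean distance from a point to a set. -/
noncomputable def einfDist {ι : Type*} [Fintype ι] (x : ι → ℝ) (A : Set (ι → ℝ)) : ℝ :=
  ⨅ a : A, eunorm (x - (a : ι → ℝ))

/-- `x` is a solution of `ẋ = F(t,x)` on `[t₀,∞)`. -/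
def IsSolOn {ι : Type*} [Fintype ι] (F : ℝ → (ι → ℝ) → ι → ℝ)
    (x : ℝ → ι → ℝ) (t₀ : ℝ) : Prop :=
  ∀ t ≥ t₀, HasDerivAt x (F t (x t)) t

/-- The nonempty compact set `A` is uniformly asymptotically stable for `ẋ = F(t,x)`,
with the open set `D ⊇ A` contained in its domain of attraction. -/
def UAS {ι : Type*} [Fintype ι] (F : ℝ → (ι → ℝ) → ι → ℝ)
    (A D : Set (ι → ℝ)) : Prop :=
  (∀ ε > 0, ∃ δ > 0, ∀ (t₀ : ℝ) (x : ℝ → ι → ℝ), IsSolOn F x t₀ →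
      einfDist (x t₀) A < δ → ∀ t ≥ t₀, einfDist (x t) A < ε) ∧
  (∀ C : Set (ι → ℝ), IsCompact C → C ⊆ D →
    (∀ (t₀ : ℝ), ∀ x₀ ∈ C, ∃ x : ℝ → ι → ℝ, x t₀ = x₀ ∧ IsSolOn F x t₀) ∧
    (∀ ε > 0, ∃ T > 0, ∀ (t₀ : ℝ) (x : ℝ → ι → ℝ), IsSolOn F x t₀ → x t₀ ∈ C →
      ∀ t ≥ t₀ + T, einfDist (x t) A < ε))


/-- `E` admits nonexpansive retractions onto centered closed balls. -/
def HasRet (E : Type*) [NormedAddCommGroup E] : Prop :=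
  ∀ ρ : ℝ, 0 ≤ ρ → ∃ φ : E → E, LipschitzWith 1 φ ∧ (∀ x, ‖φ x‖ ≤ ρ) ∧ ∀ x, ‖x‖ ≤ ρ → φ x = x

theorem hasRet_real : HasRet ℝ := by
  intro ρ hρ
  refine ⟨fun x => max (-ρ) (min ρ x), ?_, ?_, ?_⟩
  · exact (LipschitzWith.id.const_min ρ).const_max (-ρ)
  · intro x
    rw [Real.norm_eq_abs, abs_le]
    exact ⟨le_max_left _ _, max_le (by linarith) (min_le_left _ _)⟩
  · intro x hx
    rw [Real.norm_eq_abs, abs_le] at hx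
    show max (-ρ) (min ρ x) = x
    rw [min_eq_right hx.2, max_eq_right hx.1]

theorem hasRet_pi {ι : Type*} [Fintype ι] {E : Type*} [NormedAddCommGroup E] (h : HasRet E) :
    HasRet (ι → E) := by
  intro ρ hρ
  obtain ⟨φ, h1, h2, h3⟩ := h ρ hρ
  refine ⟨fun x i => φ (x i), ?_, ?_, ?_⟩
  · refine LipschitzWith.of_dist_le_mul fun x y => ?_
    rw [dist_pi_le_iff (by positivity)]
    intro i
    refine (h1.dist_le_mul (x i) (y i)).trans ?_
    gcongr
    exact dist_le_pi_dist x y i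
  · intro x
    rw [pi_norm_le_iff_of_nonneg hρ]
    exact fun i => h2 _
  · intro x hx
    funext i
    exact h3 _ ((norm_le_pi_norm x i).trans hx)

theorem exists_sol_interval {E : Type*} [NormedAddCommGroup E] [NormedSpace ℝ E] [CompleteSpace E]
    (hE : HasRet E) (G : ℝ → E → E) (K : NNReal) (M : ℝ) (hM : 0 ≤ M)
    (hc : ∀ x, Continuous fun t => G t x) (hL : ∀ t, LipschitzWith K (G t))
    (h0 : ∀ t, ‖G t 0‖ ≤ M) (t₀ : ℝ) (x₀ : E) (m : ℝ) (hm : 0 < m) :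
    ∃ y : ℝ → E, y t₀ = x₀ ∧ ∀ t, t₀ ≤ t → t < t₀ + m → HasDerivAt y (G t (y t)) t := by
  set ρ : ℝ := max 0 (gronwallBound ‖x₀‖ K M m) with hρ
  have hρ0 : 0 ≤ ρ := le_max_left _ _
  obtain ⟨φ, h1, h2, h3⟩ := hE ρ hρ0
  have hφ0 : φ 0 = 0 := h3 0 (by simpa using hρ0)
  have hφn : ∀ x, ‖φ x‖ ≤ ‖x‖ := fun x => by
    have := h1.dist_le_mul x 0
    simpa [hφ0] using this
  have hGn : ∀ t x, ‖G t x‖ ≤ K * ‖x‖ + M := fun t x => by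
    have h := (hL t).dist_le_mul x 0
    rw [dist_eq_norm, dist_zero_right] at h
    have : ‖G t x‖ ≤ ‖G t x - G t 0‖ + ‖G t 0‖ := by
      simpa using norm_add_le (G t x - G t 0) (G t 0)
    linarith [h0 t]
  set B : NNReal := ⟨K * ρ + M, by positivity⟩ with hB
  have ht0 : t₀ ∈ Set.Icc (t₀ - m) (t₀ + m) := ⟨by linarith, by linarith⟩
  have hpl : IsPicardLindelof (fun t x => G t (φ x)) (⟨t₀, ht0⟩ : Set.Icc (t₀ - m) (t₀ + m)) x₀
      (B * ⟨m, hm.le⟩) 0 B K := by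
    constructor
    · intro t _
      have := (hL t).comp h1
      rw [mul_one] at this
      exact this.lipschitzOnWith
    · intro x _
      exact (hc (φ x)).continuousOn
    · intro t _ x _
      show _ ≤ (K : ℝ) * ρ + M
      refine (hGn t (φ x)).trans ?_
      have := h2 x
      gcongr
    · simp only [add_sub_cancel_left, sub_sub_cancel, max_self, NNReal.coe_zero, sub_zero]
      exact le_rfl
  obtain ⟨y, hy0, hy⟩ := hpl.exists_eq_forall_mem_Icc_hasDerivWithinAt₀
  have hd : ∀ t, t₀ ≤ t → t < t₀ + m → HasDerivAt y (G t (φ (y t))) t := fun t h h' =>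
    (hy t ⟨by linarith, h'.le⟩).hasDerivAt (Icc_mem_nhds (by linarith) h')
  refine ⟨y, hy0, fun t h h' => ?_⟩
  have hb := norm_le_gronwallBound_of_norm_deriv_right_le (f := y) (a := t₀) (b := t₀ + m)
    (f' := fun t => G t (φ (y t))) (δ := ‖x₀‖) (K := K) (ε := M)
    (fun s hs => ((hy s ⟨by linarith [hs.1], hs.2⟩).continuousWithinAt).mono
      (Set.Icc_subset_Icc (by linarith) le_rfl))
    (fun s hs => (hd s hs.1 hs.2).hasDerivWithinAt) (by have : y t₀ = x₀ := hy0
                                                        rw [this])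
    (fun s _ => (hGn s _).trans (by have := hφn (y s); gcongr)) t ⟨h, h'.le⟩
  have : ‖y t‖ ≤ ρ := hb.trans ((gronwallBound_mono (norm_nonneg _) hM K.2
    (by linarith : t - t₀ ≤ m)).trans (le_max_right _ _))
  have := hd t h h'
  rwa [h3 _ ‹_›] at this

theorem exists_sol_global {E : Type*} [NormedAddCommGroup E] [NormedSpace ℝ E] [CompleteSpace E]
    (hE : HasRet E) (G : ℝ → E → E) (K : NNReal) (M : ℝ) (hM : 0 ≤ M)
    (hc : ∀ x, Continuous fun t => G t x) (hL : ∀ t, LipschitzWith K (G t))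
    (h0 : ∀ t, ‖G t 0‖ ≤ M) (t₀ : ℝ) (x₀ : E) :
    ∃ y : ℝ → E, y t₀ = x₀ ∧ ∀ t, t₀ ≤ t → HasDerivAt y (G t (y t)) t := by
  have H := fun m : ℕ => exists_sol_interval hE G K M hM hc hL h0 t₀ x₀ (m + 1) (by positivity)
  choose y hy0 hy using H
  have uniq : ∀ m m' : ℕ, ∀ t, t₀ ≤ t → t < t₀ + (m + 1) → t < t₀ + (m' + 1) →
      y m t = y m' t := by
    intro m m' t h1 h2 h3
    refine ODE_solution_unique_of_mem_Icc_right (v := G) (s := fun _ => Set.univ) (K := K)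
      (a := t₀) (b := t) (fun s _ => (hL s).lipschitzOnWith)
      (fun s hs => (hy m s hs.1 (by linarith [hs.2])).continuousAt.continuousWithinAt)
      (fun s hs => (hy m s hs.1 (by linarith [hs.2])).hasDerivWithinAt) (fun _ _ => trivial)
      (fun s hs => (hy m' s hs.1 (by linarith [hs.2])).continuousAt.continuousWithinAt)
      (fun s hs => (hy m' s hs.1 (by linarith [hs.2])).hasDerivWithinAt) (fun _ _ => trivial)
      (by rw [hy0, hy0]) ⟨h1, le_rfl⟩
  set x : ℝ → E := fun t => y ⌈t - t₀⌉₊ t with hx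
  have key : ∀ m : ℕ, ∀ t, t₀ ≤ t → t < t₀ + (m + 1) → x t = y m t := fun m t h1 h2 =>
    uniq _ _ t h1 (by linarith [Nat.le_ceil (t - t₀)]) h2
  refine ⟨x, by rw [key 0 t₀ le_rfl (by simp), hy0], fun t ht => ?_⟩
  rcases ht.eq_or_lt with rfl | hlt
  · have : x =ᶠ[nhds t₀] y 0 := by
      filter_upwards [Iio_mem_nhds (show t₀ < t₀ + 1 by linarith)] with u hu
      rcases le_total t₀ u with h | h
      · exact key 0 u h (by simpa using hu)
      · simp only [hx]
        rw [Nat.ceil_eq_zero.2 (by linarith)]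
    have h := (hy 0 t₀ le_rfl (by simp)).congr_of_eventuallyEq this
    rwa [← this.eq_of_nhds] at h
  · set m := ⌈t - t₀⌉₊ with hm
    have hm' : t < t₀ + (m + 1) := by linarith [Nat.le_ceil (t - t₀)]
    have : x =ᶠ[nhds t] y m := by
      filter_upwards [Ioo_mem_nhds hlt hm'] with u hu
      exact key m u hu.1.le hu.2
    have h := (hy m t ht hm').congr_of_eventuallyEq this
    rwa [← this.eq_of_nhds] at h

theorem Reg.lip_closedBall {n : ℕ} {f : ℝ → (Fin n → ℝ) → Fin n → ℝ} (hf : Reg f) (R : ℝ) :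
    ∃ L : NNReal, ∀ t, LipschitzOnWith L (f t) (Metric.closedBall 0 R) := by
  obtain ⟨-, hC, hl, -⟩ := hf
  have : ∃ L : NNReal, ∀ x ∈ Metric.closedBall (0 : Fin n → ℝ) R, ∀ t, ‖fderiv ℝ (f t) x‖₊ ≤ L := by
    refine (isCompact_closedBall (0 : Fin n → ℝ) R).induction_on
      (p := fun s => ∃ L : NNReal, ∀ x ∈ s, ∀ t, ‖fderiv ℝ (f t) x‖₊ ≤ L) ?_ ?_ ?_ ?_
    · exact ⟨0, by simp⟩
    · rintro s t hst ⟨L, h⟩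
      exact ⟨L, fun x hx => h x (hst hx)⟩
    · rintro s t ⟨L, h⟩ ⟨L', h'⟩
      refine ⟨max L L', fun x hx τ => ?_⟩
      rcases hx with hx | hx
      · exact (h x hx τ).trans (le_max_left _ _)
      · exact (h' x hx τ).trans (le_max_right _ _)
    · intro x _
      obtain ⟨L, ε, hε, h⟩ := hl x
      refine ⟨Metric.ball x ε, mem_nhdsWithin_of_mem_nhds (Metric.ball_mem_nhds x hε), L,
        fun y hy t => ?_⟩
      exact norm_fderiv_le_of_lipschitzOn ℝ (Metric.isOpen_ball.mem_nhds hy) (h t)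
  obtain ⟨L, h⟩ := this
  exact ⟨L, fun t => (convex_closedBall 0 R).lipschitzOnWith_of_nnnorm_fderiv_le
    (fun x _ => ((hC t).differentiable one_ne_zero) x) (fun x hx => h x hx t)⟩

theorem eunorm_nonneg {ι : Type*} [Fintype ι] (v : ι → ℝ) : 0 ≤ eunorm v := Real.sqrt_nonneg _

theorem eunorm_eq {ι : Type*} [Fintype ι] (v : ι → ℝ) : eunorm v = ‖WithLp.toLp 2 v‖ := by
  simp [eunorm, EuclideanSpace.norm_eq]

theorem eunorm_add_le {ι : Type*} [Fintype ι] (v w : ι → ℝ) :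
    eunorm (v + w) ≤ eunorm v + eunorm w := by
  simp only [eunorm_eq, WithLp.toLp_add]
  exact norm_add_le _ _

theorem eunorm_neg {ι : Type*} [Fintype ι] (v : ι → ℝ) : eunorm (-v) = eunorm v := by
  simp [eunorm]

theorem norm_le_eunorm {ι : Type*} [Fintype ι] (v : ι → ℝ) : ‖v‖ ≤ eunorm v := by
  rw [pi_norm_le_iff_of_nonneg (eunorm_nonneg v)]
  intro i
  refine Real.le_sqrt_of_sq_le ?_
  rw [Real.norm_eq_abs, sq_abs]
  exact Finset.single_le_sum (f := fun i => v i ^ 2) (fun i _ => sq_nonneg _) (Finset.mem_univ i)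

theorem eunorm_le {n : ℕ} (v : Fin n → ℝ) : eunorm v ≤ (n + 1) * ‖v‖ := by
  refine Real.sqrt_le_iff.2 ⟨by positivity, ?_⟩
  have : ∑ j, v j ^ 2 ≤ ∑ j : Fin n, ‖v‖ ^ 2 := Finset.sum_le_sum fun i _ => by
    rw [← sq_abs, ← Real.norm_eq_abs]
    gcongr
    exact norm_le_pi_norm v i
  simp only [Finset.sum_const, Finset.card_univ, Fintype.card_fin, nsmul_eq_mul] at this
  nlinarith [mul_nonneg (Nat.cast_nonneg (α := ℝ) n) (sq_nonneg ‖v‖), sq_nonneg ‖v‖,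
    mul_nonneg (sq_nonneg (n : ℝ)) (sq_nonneg ‖v‖)]

theorem einfDist_nonneg {ι : Type*} [Fintype ι] (x : ι → ℝ) (A : Set (ι → ℝ)) :
    0 ≤ einfDist x A := Real.iInf_nonneg fun _ => eunorm_nonneg _

theorem einfDist_le {ι : Type*} [Fintype ι] (x y : ι → ℝ) {A : Set (ι → ℝ)} (hA : A.Nonempty) :
    einfDist x A ≤ einfDist y A + eunorm (x - y) := by
  have := hA.to_subtype
  rw [← sub_le_iff_le_add]
  refine le_ciInf fun a => ?_
  rw [sub_le_iff_le_add]
  have h : einfDist x A ≤ eunorm (x - (a : ι → ℝ)) :=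
    ciInf_le ⟨0, by rintro _ ⟨b, rfl⟩; exact eunorm_nonneg _⟩ a
  have h2 := eunorm_add_le (y - (a : ι → ℝ)) (x - y)
  rw [show y - (a : ι → ℝ) + (x - y) = x - a by abel] at h2
  exact h.trans h2

theorem einfDist_lt {ι : Type*} [Fintype ι] {x : ι → ℝ} {A : Set (ι → ℝ)} (hA : A.Nonempty)
    {r : ℝ} (h : einfDist x A < r) : ∃ a ∈ A, ‖x - a‖ < r := by
  have := hA.to_subtype
  obtain ⟨a, ha⟩ := exists_lt_of_ciInf_lt h
  exact ⟨a, a.2, (norm_le_eunorm _).trans_lt ha⟩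

theorem continuous_einfDist {n : ℕ} {A : Set (Fin n → ℝ)} (hA : A.Nonempty) :
    Continuous fun x => einfDist x A := by
  have : LipschitzWith (n + 1) fun x => einfDist x A := by
    refine LipschitzWith.of_le_add_mul _ fun x y => ?_
    refine (einfDist_le x y hA).trans ?_
    rw [dist_eq_norm]
    have := eunorm_le (x - y)
    push_cast
    linarith
  exact this.continuous

theorem lapMat_mulVec {N : ℕ} (α : Fin N → Fin N → ℝ) (v : Fin N → ℝ) (i : Fin N) :
    (lapMat α *ᵥ v) i = - ∑ j, α i j * (v j - v i) := by
  simp only [lapMat, Matrix.mulVec, dotProduct, Matrix.of_apply, sub_mul, ite_mul, zero_mul,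
    Finset.sum_sub_distrib, Finset.sum_ite_eq, Finset.mem_univ, if_true, mul_sub]
  rw [Finset.sum_mul]
  ring

theorem spectral_gap {N : ℕ} (α : Fin N → Fin N → ℝ)
    (hpsd : (lapMat α).PosSemidef)
    (hconn : LinearMap.ker (lapMat α).mulVecLin
      = Submodule.span ℝ {(fun _ => 1 : Fin N → ℝ)}) :
    ∃ lam > (0 : ℝ), ∀ v : Fin N → ℝ, ∑ i, v i = 0 →
      ∑ i, v i * ∑ j, α i j * (v j - v i) ≤ - lam * ∑ i, v i ^ 2 := by
  set q : (Fin N → ℝ) → ℝ := fun v => - ∑ i, v i * ∑ j, α i j * (v j - v i) with hq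
  have hq' : ∀ v, q v = star v ⬝ᵥ (lapMat α *ᵥ v) := by
    intro v
    simp only [dotProduct, lapMat_mulVec, hq, star_trivial, mul_neg, Finset.sum_neg_distrib]
  have hqc : Continuous q := by
    simp only [hq]
    fun_prop
  have hpos : ∀ v, ∑ i, v i = 0 → v ≠ 0 → 0 < q v := by
    intro v hv hne
    rw [hq']
    refine lt_of_le_of_ne (hpsd.dotProduct_mulVec_nonneg v) fun h => hne ?_
    have hk : lapMat α *ᵥ v = 0 := (hpsd.dotProduct_mulVec_zero_iff v).1 h.symm
    have hm : v ∈ LinearMap.ker (lapMat α).mulVecLin := by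
      simpa [LinearMap.mem_ker] using hk
    rw [hconn, Submodule.mem_span_singleton] at hm
    obtain ⟨c, rfl⟩ := hm
    funext i
    have hN : (0 : ℝ) < N := by exact_mod_cast i.pos
    have : (N : ℝ) * c = 0 := by simpa using hv
    have hc : c = 0 := by
      rcases mul_eq_zero.1 this with h | h
      · exact absurd h hN.ne'
      · exact h
    simp [hc]
  set S : Set (Fin N → ℝ) := Metric.sphere 0 1 ∩ {v | ∑ i, v i = 0} with hS
  have hSc : IsCompact S :=
    (isCompact_sphere _ _).inter_right (isClosed_eq (by fun_prop) continuous_const)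
  have hmin : ∃ μ > (0 : ℝ), ∀ v ∈ S, μ ≤ q v := by
    rcases S.eq_empty_or_nonempty with h | h
    · exact ⟨1, one_pos, by simp [h]⟩
    · obtain ⟨v, hv, hvm⟩ := hSc.exists_isMinOn h hqc.continuousOn
      refine ⟨q v, hpos v hv.2 ?_, fun w hw => hvm hw⟩
      rintro rfl
      simpa using hv.1
  obtain ⟨μ, hμ, hμS⟩ := hmin
  refine ⟨μ / (N + 1), by positivity, fun v hv => ?_⟩
  have main : μ * ‖v‖ ^ 2 ≤ q v := by
    by_cases h0 : v = 0
    · subst h0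
      simp [hq]
    · have hn : 0 < ‖v‖ := norm_pos_iff.2 h0
      have h1 := hμS (‖v‖⁻¹ • v) ⟨by
        rw [mem_sphere_zero_iff_norm, norm_smul, norm_inv, norm_norm, inv_mul_cancel₀ hn.ne'], by
        simp only [Set.mem_ofPred_eq, Pi.smul_apply, smul_eq_mul]
        rw [← Finset.mul_sum, hv, mul_zero]⟩
      have h2 : q (‖v‖⁻¹ • v) = (‖v‖ ^ 2)⁻¹ * q v := by
        rw [hq', hq', Matrix.mulVec_smul]
        simp only [star_trivial, smul_dotProduct, dotProduct_smul, smul_eq_mul]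
        field_simp
      rw [h2, inv_mul_eq_div, le_div_iff₀ (by positivity)] at h1
      exact h1
  have hsum : ∑ i, v i ^ 2 ≤ (N + 1) * ‖v‖ ^ 2 := by
    have : ∑ j, v j ^ 2 ≤ ∑ j : Fin N, ‖v‖ ^ 2 := Finset.sum_le_sum fun i _ => by
      rw [← sq_abs, ← Real.norm_eq_abs]
      gcongr
      exact norm_le_pi_norm v i
    simp only [Finset.sum_const, Finset.card_univ, Fintype.card_fin, nsmul_eq_mul] at this
    linarith [sq_nonneg ‖v‖]
  have : μ / (N + 1) * ∑ i, v i ^ 2 ≤ μ * ‖v‖ ^ 2 := by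
    calc μ / (N + 1) * ∑ i, v i ^ 2 ≤ μ / (N + 1) * ((N + 1) * ‖v‖ ^ 2) := by gcongr
      _ = μ * ‖v‖ ^ 2 := by field_simp
  simp only [hq] at main
  linarith

/-- mean of the agents -/
noncomputable def meanV {N n : ℕ} (X : Fin N → Fin n → ℝ) : Fin n → ℝ := (N : ℝ)⁻¹ • ∑ i, X i

/-- squared disagreement -/
noncomputable def disV {N n : ℕ} (X : Fin N → Fin n → ℝ) : ℝ :=
  ∑ l, ∑ i, (X i l - meanV X l) ^ 2

theorem sum_sub_meanV {N n : ℕ} (hN : 2 ≤ N) (X : Fin N → Fin n → ℝ) (l : Fin n) :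
    ∑ i, (X i l - meanV X l) = 0 := by
  have : (N : ℝ) ≠ 0 := by positivity
  simp only [meanV, Finset.sum_sub_distrib, Pi.smul_apply, Finset.sum_apply, smul_eq_mul,
    Finset.sum_const, Finset.card_univ, Fintype.card_fin, nsmul_eq_mul]
  field_simp
  ring

theorem eunorm_sub_meanV {N n : ℕ} (X : Fin N → Fin n → ℝ) (i : Fin N) :
    eunorm (X i - meanV X) ≤ √(disV X) := by
  refine Real.sqrt_le_sqrt ?_
  refine Finset.sum_le_sum fun l _ => ?_
  exact Finset.single_le_sum (f := fun i => (X i l - meanV X l) ^ 2) (fun i _ => sq_nonneg _)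
    (Finset.mem_univ i)

theorem disV_decay {N n : ℕ} (hN : 2 ≤ N) (α : Fin N → Fin N → ℝ) (lam : ℝ) (hlam : 0 < lam)
    (hgap : ∀ v : Fin N → ℝ, ∑ i, v i = 0 →
      ∑ i, v i * ∑ j, α i j * (v j - v i) ≤ - lam * ∑ i, v i ^ 2)
    (hsym : ∀ i j, α i j = α j i)
    (k : ℝ) (hk : 0 < k) (t₀ M : ℝ) (hM : 0 ≤ M)
    (u : ℝ → Fin N → Fin n → ℝ) (hu : ∀ t i, ‖u t i‖ ≤ M)
    (X : ℝ → Fin N → Fin n → ℝ)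
    (hX : ∀ t, t₀ ≤ t → HasDerivAt X (fun i => u t i + k • ∑ j, α i j • (X t j - X t i)) t) :
    (∀ t, t₀ ≤ t → HasDerivAt (fun t => meanV (X t)) ((N : ℝ)⁻¹ • ∑ i, u t i) t) ∧
    ∀ t, t₀ ≤ t → disV (X t) ≤ Real.exp (-(k * lam) * (t - t₀)) * disV (X t₀)
      + N * n * M ^ 2 / (k * lam) ^ 2 := by
  have hXi : ∀ t, t₀ ≤ t → ∀ i, HasDerivAt (fun t => X t i)
      (u t i + k • ∑ j, α i j • (X t j - X t i)) t := fun t ht i => hasDerivAt_pi.1 (hX t ht) i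
  have hmean : ∀ t, t₀ ≤ t → HasDerivAt (fun t => meanV (X t)) ((N : ℝ)⁻¹ • ∑ i, u t i) t := by
    intro t ht
    have h := (HasDerivAt.fun_sum (u := Finset.univ) fun i _ => hXi t ht i).const_smul (N : ℝ)⁻¹
    have h0 : ∑ i, ∑ j, α i j • (X t j - X t i) = 0 := by
      have h1 : ∑ i, ∑ j, α i j • (X t j - X t i) = ∑ i, ∑ j, α j i • (X t i - X t j) :=
        Finset.sum_comm
      have h2 : ∑ i, ∑ j, α j i • (X t i - X t j) = - ∑ i, ∑ j, α i j • (X t j - X t i) := by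
        simp only [← Finset.sum_neg_distrib]
        refine Finset.sum_congr rfl fun i _ => Finset.sum_congr rfl fun j _ => ?_
        rw [hsym i j, ← smul_neg, neg_sub]
      exact self_eq_neg.1 (h1.trans h2)
    rw [Finset.sum_add_distrib, ← Finset.smul_sum, h0, smul_zero, add_zero] at h
    exact h
  refine ⟨hmean, ?_⟩
  set κ := k * lam with hκ
  have hκ0 : 0 < κ := mul_pos hk hlam
  set P : ℝ := N * n * M ^ 2 with hP
  set V' : ℝ → ℝ := fun t => ∑ l, ∑ i, 2 * (X t i l - meanV (X t) l) *
    ((u t i l + k * ∑ j, α i j * (X t j l - X t i l)) - ((N : ℝ)⁻¹ • ∑ i, u t i) l) with hV'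
  have hV : ∀ t, t₀ ≤ t → HasDerivAt (fun t => disV (X t)) (V' t) t := by
    intro t ht
    unfold disV
    refine HasDerivAt.fun_sum fun l _ => HasDerivAt.fun_sum fun i _ => ?_
    have h1 := hasDerivAt_pi.1 (hXi t ht i) l
    have h2 := hasDerivAt_pi.1 (hmean t ht) l
    have h3 := (h1.sub h2).pow 2
    refine HasDerivAt.congr_deriv (f := fun t => (X t i l - meanV (X t) l) ^ 2) h3 ?_
    simp
  have hVle : ∀ t, t₀ ≤ t → V' t ≤ -κ * disV (X t) + P / κ := by
    intro t ht
    have hl : ∀ l, ∑ i, 2 * (X t i l - meanV (X t) l) *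
      ((u t i l + k * ∑ j, α i j * (X t j l - X t i l)) - ((N : ℝ)⁻¹ • ∑ i, u t i) l)
        ≤ -κ * ∑ i, (X t i l - meanV (X t) l) ^ 2 + N * M ^ 2 / κ := by
      intro l
      set v : Fin N → ℝ := fun i => X t i l - meanV (X t) l with hv
      set c := ((N : ℝ)⁻¹ • ∑ i, u t i) l
      have hv0 : ∑ i, v i = 0 := sum_sub_meanV hN (X t) l
      have hg := hgap v hv0
      have e1 : ∀ i, 2 * (X t i l - meanV (X t) l) *
          ((u t i l + k * ∑ j, α i j * (X t j l - X t i l)) - c)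
          = 2 * (v i * u t i l) + 2 * k * (v i * ∑ j, α i j * (v j - v i)) - 2 * c * v i := by
        intro i
        simp only [hv, sub_sub_sub_cancel_right]
        ring
      rw [Finset.sum_congr rfl fun i _ => e1 i, Finset.sum_sub_distrib, Finset.sum_add_distrib,
        ← Finset.mul_sum, ← Finset.mul_sum, ← Finset.mul_sum, hv0]
      have e2 : 2 * ∑ i, v i * u t i l ≤ κ * ∑ i, v i ^ 2 + N * M ^ 2 / κ := by
        have : N * M ^ 2 / κ = ∑ i : Fin N, M ^ 2 / κ := by
          simp only [Finset.sum_const, Finset.card_univ, Fintype.card_fin, nsmul_eq_mul]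
          ring
        rw [this, Finset.mul_sum, Finset.mul_sum, ← Finset.sum_add_distrib]
        refine Finset.sum_le_sum fun i _ => ?_
        have hb : |u t i l| ≤ M := (norm_le_pi_norm (u t i) l).trans (hu t i)
        have hb2 : (u t i l) ^ 2 ≤ M ^ 2 := by
          rw [← sq_abs]
          gcongr
        have e3 : 2 * (v i * u t i l) ≤ κ * v i ^ 2 + (u t i l) ^ 2 / κ := by
          have h : 0 ≤ (κ * v i - u t i l) ^ 2 / κ := by positivity
          have h' : (κ * v i - u t i l) ^ 2 / κ
            = κ * v i ^ 2 + (u t i l) ^ 2 / κ - 2 * (v i * u t i l) := by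
            field_simp
            ring
          linarith
        have e4 : (u t i l) ^ 2 / κ ≤ M ^ 2 / κ := by gcongr
        linarith
      have e5 : 2 * k * ∑ i, v i * ∑ j, α i j * (v j - v i) ≤ 2 * k * (- lam * ∑ i, v i ^ 2) := by
        gcongr
      have e6 : 2 * k * (- lam * ∑ i, v i ^ 2) = -2 * (κ * ∑ i, v i ^ 2) := by
        rw [hκ]
        ring
      linarith
    calc V' t ≤ ∑ l : Fin n, (-κ * ∑ i, (X t i l - meanV (X t) l) ^ 2 + N * M ^ 2 / κ) :=
          Finset.sum_le_sum fun l _ => hl l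
      _ = -κ * disV (X t) + P / κ := by
          rw [Finset.sum_add_distrib, ← Finset.mul_sum, disV]
          simp only [Finset.sum_const, Finset.card_univ, Fintype.card_fin, nsmul_eq_mul]
          rw [hP]
          ring
  intro t ht
  set W : ℝ → ℝ := fun t => Real.exp (κ * (t - t₀)) * (disV (X t) - P / κ ^ 2) with hW
  have hWd : ∀ t, t₀ ≤ t → HasDerivAt W (Real.exp (κ * (t - t₀)) * κ * (disV (X t) - P / κ ^ 2)
      + Real.exp (κ * (t - t₀)) * V' t) t := by
    intro t ht
    have h1 : HasDerivAt (fun t => Real.exp (κ * (t - t₀))) (Real.exp (κ * (t - t₀)) * κ) t := by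
      have := (((hasDerivAt_id t).sub_const t₀).const_mul κ).exp
      simpa using this
    exact h1.mul ((hV t ht).sub_const _)
  have hanti : AntitoneOn W (Set.Ici t₀) := by
    refine antitoneOn_of_deriv_nonpos (convex_Ici t₀)
      (fun s hs => (hWd s hs).continuousAt.continuousWithinAt) ?_ ?_
    · intro s hs
      rw [interior_Ici] at hs
      exact (hWd s (le_of_lt hs)).differentiableAt.differentiableWithinAt
    · intro s hs
      rw [interior_Ici] at hs
      have hs' : t₀ ≤ s := le_of_lt hs
      rw [(hWd s hs').deriv]
      have h1 := hVle s hs'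
      have h2 : Real.exp (κ * (s - t₀)) * κ * (disV (X s) - P / κ ^ 2)
        + Real.exp (κ * (s - t₀)) * V' s = Real.exp (κ * (s - t₀)) *
          (V' s - (-κ * disV (X s) + P / κ)) := by
        field_simp
        ring
      rw [h2]
      exact mul_nonpos_of_nonneg_of_nonpos (Real.exp_pos _).le (by linarith)
  have hWt := hanti (Set.mem_Ici.2 le_rfl) (Set.mem_Ici.2 ht) ht
  simp only [hW, sub_self, mul_zero, Real.exp_zero, one_mul] at hWt
  have hE : Real.exp (-κ * (t - t₀)) * Real.exp (κ * (t - t₀)) = 1 := by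
    rw [← Real.exp_add]
    simp
  have h3 := mul_le_mul_of_nonneg_left hWt (Real.exp_pos (-κ * (t - t₀))).le
  rw [← mul_assoc, hE, one_mul] at h3
  have h4 : 0 ≤ Real.exp (-κ * (t - t₀)) * (P / κ ^ 2) := by positivity
  linarith

theorem tracking {N n : ℕ} (hN : 2 ≤ N) (g : Fin N → ℝ → (Fin n → ℝ) → Fin n → ℝ)
    (L : NNReal) (hL0 : 0 < L) (hL : ∀ i t, LipschitzWith L (g i t))
    (X : ℝ → Fin N → Fin n → ℝ) (s z : ℝ → Fin n → ℝ) (a T ρ E c κ : ℝ) (hE : 0 ≤ E)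
    (hT : 0 ≤ T) (hρ : 0 ≤ ρ) (hc : 0 < c) (hκ : 0 < κ)
    (hs : ∀ t, a ≤ t → HasDerivAt s ((N : ℝ)⁻¹ • ∑ i, g i t (X t i)) t)
    (hzc : ContinuousOn z (Set.Icc a (a + T)))
    (hz : ∀ t ∈ Set.Ico a (a + T), HasDerivAt z ((N : ℝ)⁻¹ • ∑ i, g i t (z t)) t)
    (he : ∀ t, a ≤ t → ∀ i, ‖X t i - s t‖ ≤ E * Real.exp (-κ * (t - a)) + c)
    (h0 : ‖s a - z a‖ ≤ ρ) :
    ∀ t ∈ Set.Icc a (a + T),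
      ‖s t - z t‖ ≤ (ρ + L * E / κ + 2 * L * c * T) * Real.exp (L * T) := by
  have hN0 : (N : ℝ) ≠ 0 := by positivity
  set ψ : ℝ → ℝ := fun t => ρ + L * E / κ * (1 - Real.exp (-κ * (t - a))) + 2 * L * c * (t - a)
    with hψ
  set B : ℝ → ℝ := fun t => ψ t * Real.exp (L * (t - a)) with hB
  set B' : ℝ → ℝ := fun t => (L * E * Real.exp (-κ * (t - a)) + 2 * L * c) *
    Real.exp (L * (t - a)) + ψ t * (Real.exp (L * (t - a)) * L) with hB'
  have hBd : ∀ t, HasDerivAt B (B' t) t := by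
    intro t
    have h1 : ∀ r : ℝ, HasDerivAt (fun t => Real.exp (r * (t - a))) (Real.exp (r * (t - a)) * r) t := by
      intro r
      have := (((hasDerivAt_id t).sub_const a).const_mul r).exp
      simpa using this
    have h2 : HasDerivAt ψ (L * E * Real.exp (-κ * (t - a)) + 2 * L * c) t := by
      have h3 := ((((h1 (-κ)).const_sub 1).const_mul (L * E / κ)).const_add ρ).add
        (((hasDerivAt_id t).sub_const a).const_mul (2 * L * c))
      refine HasDerivAt.congr_deriv (f := ψ) h3 ?_
      field_simp
    exact h2.mul (h1 L)
  have hL0' : (0 : ℝ) < L := hL0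
  have key := image_norm_le_of_norm_deriv_right_lt_deriv_boundary (f := fun t => s t - z t)
    (f' := fun t => (N : ℝ)⁻¹ • ∑ i, g i t (X t i) - (N : ℝ)⁻¹ • ∑ i, g i t (z t))
    (a := a) (b := a + T) (B := B) (B' := B')
    (ContinuousOn.sub (fun t ht => (hs t ht.1).continuousAt.continuousWithinAt) hzc)
    (fun t ht => ((hs t ht.1).sub (hz t ht)).hasDerivWithinAt)
    (by simpa [hB, hψ] using h0) hBd ?_
  · intro t ht
    refine (key ht).trans ?_
    have h1 : t - a ≤ T := by linarith [ht.2]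
    have h1' : 0 ≤ t - a := by linarith [ht.1]
    have h2 : 0 ≤ L * E / κ := by positivity
    have h3 : ψ t ≤ ρ + L * E / κ + 2 * L * c * T := by
      have h4 : L * E / κ * (1 - Real.exp (-κ * (t - a))) ≤ L * E / κ * 1 := by
        gcongr
        linarith [Real.exp_pos (-κ * (t - a))]
      have h5 : 2 * L * c * (t - a) ≤ 2 * L * c * T := by gcongr
      simp only [hψ]
      linarith
    simp only [hB]
    gcongr
  · intro t ht hBt
    have hb : ∀ i, ‖g i t (X t i) - g i t (z t)‖
        ≤ L * (E * Real.exp (-κ * (t - a)) + c + B t) := by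
      intro i
      have h := (hL i t).dist_le_mul (X t i) (z t)
      rw [dist_eq_norm, dist_eq_norm] at h
      refine h.trans ?_
      gcongr
      have h2 : X t i - z t = (X t i - s t) + (s t - z t) := by abel
      rw [h2]
      refine (norm_add_le _ _).trans ?_
      rw [hBt]
      linarith [he t ht.1 i]
    have h1 : ‖(N : ℝ)⁻¹ • ∑ i, g i t (X t i) - (N : ℝ)⁻¹ • ∑ i, g i t (z t)‖
        ≤ L * (E * Real.exp (-κ * (t - a)) + c + B t) := by
      rw [← smul_sub, ← Finset.sum_sub_distrib, norm_smul, norm_inv, Real.norm_natCast,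
        inv_mul_le_iff₀ (by positivity)]
      refine (norm_sum_le_of_le _ fun i _ => hb i).trans ?_
      simp
    refine h1.trans_lt ?_
    have h2 : 1 ≤ Real.exp (L * (t - a)) :=
      Real.one_le_exp (mul_nonneg hL0'.le (by linarith [ht.1]))
    have h3 : (L * E * Real.exp (-κ * (t - a)) + 2 * L * c) * 1 ≤
      (L * E * Real.exp (-κ * (t - a)) + 2 * L * c) * Real.exp (L * (t - a)) := by
      gcongr
    simp only [hB', hB]
    have : (0 : ℝ) < L * c := by positivity
    linarith

theorem trunc_field {N n : ℕ} (f : Fin N → ℝ → (Fin n → ℝ) → Fin n → ℝ)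
    (hreg : ∀ i, Reg (f i)) (R : ℝ) (hR : 0 ≤ R) :
    ∃ φ : (Fin n → ℝ) → Fin n → ℝ, ∃ L : NNReal, ∃ M : ℝ, 0 < L ∧ 0 ≤ M ∧
      (∀ x, ‖x‖ ≤ R → φ x = x) ∧ (∀ i t, LipschitzWith L fun x => f i t (φ x)) ∧
      ∀ i t x, ‖f i t (φ x)‖ ≤ M := by
  obtain ⟨φ, h1, h2, h3⟩ := hasRet_pi (ι := Fin n) hasRet_real R hR
  choose L hL using fun i => (hreg i).lip_closedBall R
  choose C hC using fun i => (hreg i).2.2.2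
  have hLi : ∀ i, L i ≤ ∑ i, L i := fun i =>
    Finset.single_le_sum (f := L) (fun _ _ => zero_le) (Finset.mem_univ i)
  have hCi : ∀ i, |C i| ≤ ∑ i, |C i| := fun i =>
    Finset.single_le_sum (f := fun i => |C i|) (fun _ _ => abs_nonneg _) (Finset.mem_univ i)
  have hS0 : 0 ≤ ∑ i, |C i| := Finset.sum_nonneg fun _ _ => abs_nonneg _
  set L' : NNReal := ∑ i, L i + 1 with hL'
  have hmem : ∀ x, φ x ∈ Metric.closedBall (0 : Fin n → ℝ) R := fun x => by
    simpa using h2 x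
  refine ⟨φ, L', L' * R + ∑ i, |C i|, by positivity, by positivity, h3, ?_, ?_⟩
  · intro i t
    refine LipschitzWith.of_dist_le_mul fun x y => ?_
    have ha := (hL i t).dist_le_mul (φ x) (hmem x) (φ y) (hmem y)
    have hb := h1.dist_le_mul x y
    simp only [NNReal.coe_one, one_mul] at hb
    have hc : (L i : ℝ) ≤ L' := by
      have : L i ≤ L' := (hLi i).trans (by simp [hL'])
      exact_mod_cast this
    exact ha.trans (mul_le_mul hc hb dist_nonneg L'.2)
  · intro i t x
    have ha := (hL i t).dist_le_mul (φ x) (hmem x) 0 (by simpa using hR)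
    rw [dist_eq_norm, dist_zero_right] at ha
    have hc : (L i : ℝ) ≤ L' := by
      have : L i ≤ L' := (hLi i).trans (by simp [hL'])
      exact_mod_cast this
    have hd : ‖f i t 0‖ ≤ ∑ i, |C i| :=
      (norm_le_eunorm _).trans ((hC i t).trans ((le_abs_self _).trans (hCi i)))
    have he : ‖f i t (φ x)‖ ≤ ‖f i t (φ x) - f i t 0‖ + ‖f i t 0‖ := by
      simpa using norm_add_le (f i t (φ x) - f i t 0) (f i t 0)
    have hg := mul_le_mul hc (h2 x) (norm_nonneg _) L'.2
    linarith

theorem network_sol {N n : ℕ} (α : Fin N → Fin N → ℝ) (g : Fin N → ℝ → (Fin n → ℝ) → Fin n → ℝ)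
    (L : NNReal) (M : ℝ) (hM : 0 ≤ M) (hL : ∀ i t, LipschitzWith L (g i t))
    (hb : ∀ i t x, ‖g i t x‖ ≤ M) (hc : ∀ i x, Continuous fun t => g i t x) (k t₀ : ℝ)
    (X₀ : Fin N → Fin n → ℝ) :
    ∃ X : ℝ → Fin N → Fin n → ℝ, X t₀ = X₀ ∧ ∀ t, t₀ ≤ t →
      HasDerivAt X (fun i => g i t (X t i) + k • ∑ j, α i j • (X t j - X t i)) t := by
  set Λ : (Fin N → Fin n → ℝ) →ₗ[ℝ] (Fin N → Fin n → ℝ) :=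
    LinearMap.pi fun i => k • ∑ j, α i j • ((LinearMap.proj j : (Fin N → Fin n → ℝ) →ₗ[ℝ] (Fin n → ℝ)) - LinearMap.proj i) with hΛ
  set Λ' := LinearMap.toContinuousLinearMap Λ with hΛ'
  have hΛa : ∀ X i, Λ' X i = k • ∑ j, α i j • (X j - X i) := by
    intro X i
    simp [hΛ', hΛ]
  have hg : ∀ t, LipschitzWith L fun (X : Fin N → Fin n → ℝ) (i : Fin N) => g i t (X i) := by
    intro t
    refine LipschitzWith.of_dist_le_mul fun x y => ?_
    rw [dist_pi_le_iff (by positivity)]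
    intro i
    refine ((hL i t).dist_le_mul (x i) (y i)).trans ?_
    gcongr
    exact dist_le_pi_dist x y i
  obtain ⟨X, hX0, hX⟩ := exists_sol_global (hasRet_pi (ι := Fin N) (hasRet_pi (ι := Fin n)
    hasRet_real)) (fun t X => (fun i => g i t (X i)) + Λ' X) (L + ‖Λ'‖₊) M hM
    (fun X => by
      refine Continuous.add ?_ continuous_const
      exact continuous_pi fun i => hc i (X i))
    (fun t => (hg t).add Λ'.lipschitz)
    (fun t => by
      rw [map_zero, add_zero, pi_norm_le_iff_of_nonneg hM]
      exact fun i => hb i t _) t₀ X₀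
  refine ⟨X, hX0, fun t ht => ?_⟩
  refine (hX t ht).congr_deriv ?_
  funext i
  rw [Pi.add_apply, hΛa]

set_option maxHeartbeats 2000000 in
theorem local_main
    {N n : ℕ} (hN : 2 ≤ N) (t₀ : ℝ)
    (α : Fin N → Fin N → ℝ)
    (hsym : ∀ i j, α i j = α j i)
    (hpsd : (lapMat α).PosSemidef)
    (hconn : LinearMap.ker (lapMat α).mulVecLin
      = Submodule.span ℝ {(fun _ => 1 : Fin N → ℝ)})
    (f : Fin N → ℝ → (Fin n → ℝ) → Fin n → ℝ)
    (hreg : ∀ i, Reg (f i))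
    (Ab Db : Set (Fin n → ℝ))
    (hAb : Ab.Nonempty) (hAbc : IsCompact Ab) (hDb : IsOpen Db) (hAD : Ab ⊆ Db)
    (hUAS : UAS (fun t s => (N : ℝ)⁻¹ • ∑ i, f i t s) Ab Db)
    (Xc : Fin N → Fin n → ℝ) (hXc : meanV Xc ∈ Db)
    (η : ℝ) (hη : 0 < η) :
    ∃ U ∈ nhds Xc, ∃ kstar > (0:ℝ), ∀ k > kstar, ∀ X₀ ∈ U,
      ∃ x : Fin N → ℝ → Fin n → ℝ,
        (∀ i, x i t₀ = X₀ i) ∧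
        (∀ i, ∀ t ≥ t₀, HasDerivAt (x i)
          (f i t (x i t) + k • ∑ j, α i j • (x j t - x i t)) t) ∧
        (∀ i j, LimsupLE (fun t => eunorm (x i t - x j t)) η) ∧
        (∀ i, LimsupLE (fun t => einfDist (x i t) Ab) η) := by
  obtain ⟨lam, hlam, hgap⟩ := spectral_gap α hpsd hconn
  obtain ⟨hstab, hattr⟩ := hUAS
  obtain ⟨δ₁, hδ₁, hstab⟩ := hstab (η / 4) (by positivity)
  obtain ⟨r, hr, hrD⟩ := hAbc.exists_thickening_subset_open hDb hAD
  obtain ⟨RA, hRA⟩ := hAbc.isBounded.exists_norm_le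
  have hbd : ∀ x ρ, einfDist x Ab < ρ → ‖x‖ ≤ RA + ρ := by
    intro x ρ hx
    obtain ⟨a, ha, hxa⟩ := einfDist_lt hAb hx
    have : ‖x‖ ≤ ‖a‖ + ‖x - a‖ := by simpa using norm_add_le a (x - a)
    linarith [hRA a ha]
  set δ := min δ₁ (min r (η / 4)) with hδ
  have hδ0 : 0 < δ := by positivity
  have hδ1 : δ ≤ δ₁ := min_le_left _ _
  have hδr : δ ≤ r := (min_le_right _ _).trans (min_le_left _ _)
  have hδη : δ ≤ η / 4 := (min_le_right _ _).trans (min_le_right _ _)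
  set C1 : Set (Fin n → ℝ) := {x | einfDist x Ab ≤ δ / 2} with hC1
  have hC1c : IsCompact C1 := by
    refine Metric.isCompact_of_isClosed_isBounded
      (isClosed_le (continuous_einfDist hAb) continuous_const) ?_
    refine isBounded_iff_forall_norm_le.2 ⟨RA + δ, fun x hx => hbd x δ ?_⟩
    have : einfDist x Ab ≤ δ / 2 := hx
    linarith
  have hC1D : C1 ⊆ Db := by
    intro x hx
    have hx' : einfDist x Ab ≤ δ / 2 := hx
    obtain ⟨a, ha, hxa⟩ := einfDist_lt hAb (show einfDist x Ab < r by linarith)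
    exact hrD (Metric.mem_thickening_iff.2 ⟨a, ha, by rwa [dist_eq_norm]⟩)
  obtain ⟨hex1, hat1⟩ := hattr C1 hC1c hC1D
  obtain ⟨T1, hT1, hat1⟩ := hat1 (δ / 4) (by positivity)
  obtain ⟨hex0, hat0⟩ := hattr {meanV Xc} isCompact_singleton (by simpa using hXc)
  obtain ⟨T0, hT0, hat0⟩ := hat0 (δ / 4) (by positivity)
  obtain ⟨z0, hz00, hz0⟩ := hex0 t₀ (meanV Xc) rfl
  have hz0T := hat0 t₀ z0 hz0 (by simp [hz00]) (t₀ + T0) le_rfl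
  have hz0c : ContinuousOn z0 (Set.Icc t₀ (t₀ + T0)) := fun t ht =>
    (hz0 t ht.1).continuousAt.continuousWithinAt
  obtain ⟨Rz0, hRz0⟩ := isCompact_Icc.exists_bound_of_continuousOn hz0c
  set Rz : ℝ := max Rz0 (max (RA + η / 4) 0) with hRz
  have hRzz : ∀ t ∈ Set.Icc t₀ (t₀ + T0), ‖z0 t‖ ≤ Rz := fun t ht =>
    (hRz0 t ht).trans (le_max_left _ _)
  have hRze : ∀ x, einfDist x Ab < η / 4 → ‖x‖ ≤ Rz := fun x hx =>
    (hbd x _ hx).trans ((le_max_left _ _).trans (le_max_right _ _))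
  have hRz_nn : 0 ≤ Rz := (le_max_right _ _).trans (le_max_right _ _)
  set E : ℝ := √(disV Xc + 1) with hE
  have hE0 : 0 ≤ E := Real.sqrt_nonneg _
  set R : ℝ := Rz + E + 2 with hR
  obtain ⟨φ, L, M, hL0, hM, hφ, hLip, hbdg⟩ := trunc_field f hreg R (by positivity)
  have hL0' : (0 : ℝ) < L := hL0
  set θ : ℝ := min 1 (δ / (4 * (n + 1))) with hθ
  have hθ0 : 0 < θ := by positivity
  have hθ1 : θ ≤ 1 := min_le_left _ _
  have hθn : (n + 1) * θ ≤ δ / 4 := by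
    have h : θ ≤ δ / (4 * (n + 1)) := min_le_right _ _
    rw [le_div_iff₀ (by positivity)] at h
    linarith
  set T : ℝ := max T0 T1 with hT
  have hTpos : 0 < T := lt_max_of_lt_left hT0
  set ρ : ℝ := θ * Real.exp (-(L * T)) / 2 with hρ
  have hρ0 : 0 < ρ := by positivity
  have hρθ : 2 * ρ * Real.exp (L * T) = θ := by
    have : Real.exp (-(L * T)) * Real.exp (L * T) = 1 := by
      rw [← Real.exp_add]
      simp
    rw [hρ]
    linear_combination θ * this
  have hmc : Continuous (meanV : (Fin N → Fin n → ℝ) → _) := by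
    unfold meanV
    fun_prop
  have hdc : Continuous (disV : (Fin N → Fin n → ℝ) → _) := by
    unfold disV
    fun_prop
  set P : ℝ := N * n * M ^ 2 with hP
  have hP0 : 0 ≤ P := by positivity
  set c' : ℝ := √P + 1 with hc'
  have hc'0 : 0 < c' := by positivity
  set Q : ℝ := L * E + 2 * L * c' * T with hQ
  have hQ0 : 0 < Q := by positivity
  set κs : ℝ := Q / ρ + c' + 4 * c' / η with hκs
  have hκs0 : 0 < κs := by positivity
  refine ⟨{X | disV X < disV Xc + 1 ∧ ‖meanV X - meanV Xc‖ < ρ}, ?_, 2 * κs / lam, by positivity,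
    ?_⟩
  · refine IsOpen.mem_nhds ?_ ⟨by linarith, by simpa using hρ0⟩
    exact (isOpen_lt hdc continuous_const).inter
      (isOpen_lt (hmc.sub continuous_const).norm continuous_const)
  intro k hk X₀ hX₀
  obtain ⟨hX₀d, hX₀m⟩ := hX₀
  rw [gt_iff_lt, div_lt_iff₀ hlam] at hk
  set κ : ℝ := k * lam / 2 with hκ
  have hκκ : κs < κ := by
    rw [hκ]
    linarith
  have hκ0 : 0 < κ := hκs0.trans hκκ
  have hk0 : 0 < k := by
    have : 0 < k * lam := by linarith
    exact (pos_iff_pos_of_mul_pos this).2 hlam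
  have hκ1 : Q / κ ≤ ρ := by
    rw [div_le_iff₀ hκ0, mul_comm, ← div_le_iff₀ hρ0]
    have : 0 < 4 * c' / η := by positivity
    linarith
  set c : ℝ := c' / κ with hc
  have hc0 : 0 < c := by positivity
  have hc1 : c ≤ 1 := by
    rw [hc, div_le_one hκ0]
    have : 0 < 4 * c' / η := by positivity
    have : 0 < Q / ρ := by positivity
    linarith
  have hcη : c ≤ η / 4 := by
    have h1 : 4 * c' / η ≤ κ := by
      have : 0 < Q / ρ := by positivity
      linarith
    rw [div_le_iff₀ hη] at h1
    rw [hc, div_le_iff₀ hκ0]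
    linarith
  obtain ⟨X, hX0, hX⟩ := network_sol α (fun i t x => f i t (φ x)) L M hM hLip hbdg
    (fun i x => (hreg i).1.comp (by fun_prop : Continuous fun t : ℝ => (t, φ x))) k t₀ X₀
  obtain ⟨hmean, hdis⟩ := disV_decay hN α lam hlam hgap hsym k hk0 t₀ M hM
    (fun t i => f i t (φ (X t i))) (fun t i => hbdg i t _) X hX
  set s : ℝ → Fin n → ℝ := fun t => meanV (X t) with hs
  have hdisE : ∀ t, t₀ ≤ t → ∀ i, eunorm (X t i - s t) ≤ E * Real.exp (-κ * (t - t₀)) + c := by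
    intro t ht i
    refine (eunorm_sub_meanV (X t) i).trans ?_
    refine Real.sqrt_le_iff.2 ⟨by positivity, (hdis t ht).trans ?_⟩
    have h1 : Real.exp (-(k * lam) * (t - t₀)) = Real.exp (-κ * (t - t₀)) ^ 2 := by
      rw [← Real.exp_nat_mul, hκ]
      congr 1
      push_cast
      ring
    have h2 : disV (X t₀) ≤ E ^ 2 := by
      rw [hX0, hE, Real.sq_sqrt]
      · exact hX₀d.le
      · have : 0 ≤ disV Xc := Finset.sum_nonneg fun _ _ => Finset.sum_nonneg fun _ _ => sq_nonneg _
        linarith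
    have h3 : N * n * M ^ 2 / (k * lam) ^ 2 ≤ c ^ 2 := by
      have h4 : k * lam = 2 * κ := by
        rw [hκ]
        ring
      rw [h4, hc, div_pow]
      have h5 : P ≤ c' ^ 2 := by
        have := Real.sq_sqrt hP0
        have := Real.sqrt_nonneg P
        rw [hc']
        nlinarith
      have h6 : κ ^ 2 ≤ (2 * κ) ^ 2 := by nlinarith
      gcongr
    rw [h1]
    set e := Real.exp (-κ * (t - t₀)) with he
    have he0 : 0 < e := Real.exp_pos _
    have h7 : e ^ 2 * disV (X t₀) ≤ e ^ 2 * E ^ 2 := by gcongr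
    have h8 : 0 ≤ E * e * c := by positivity
    nlinarith
  have hdisN : ∀ a, t₀ ≤ a → ∀ t, a ≤ t → ∀ i,
      ‖X t i - s t‖ ≤ E * Real.exp (-κ * (t - a)) + c := by
    intro a ha t ht i
    refine (norm_le_eunorm _).trans ((hdisE t (ha.trans ht) i).trans ?_)
    have : Real.exp (-κ * (t - t₀)) ≤ Real.exp (-κ * (t - a)) := by
      apply Real.exp_le_exp.2
      nlinarith
    gcongr
  have track : ∀ a, t₀ ≤ a → ∀ T', 0 < T' → T' ≤ T → ∀ z : ℝ → Fin n → ℝ,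
      IsSolOn (fun t s => (N : ℝ)⁻¹ • ∑ i, f i t s) z a →
      (∀ t ∈ Set.Icc a (a + T'), ‖z t‖ ≤ Rz) → ‖s a - z a‖ ≤ ρ →
      ∀ t ∈ Set.Icc a (a + T'), ‖s t - z t‖ ≤ θ := by
    intro a ha T' hT'0 hT'T z hz hzR hza t ht
    have h := tracking hN (fun i t x => f i t (φ x)) L hL0 hLip X s z a T' ρ E c κ hE0 hT'0.le
      hρ0.le hc0 hκ0 (fun t ht => hmean t (ha.trans ht))
      (fun t ht => (hz t ht.1).continuousAt.continuousWithinAt)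
      (fun t ht => by
        have h1 : φ (z t) = z t := hφ _ ((hzR t ⟨ht.1, ht.2.le⟩).trans (by linarith))
        simp only [h1]
        exact hz t ht.1)
      (fun t ht => hdisN a ha t ht) hza t ht
    refine h.trans ?_
    have h1 : L * E / κ + 2 * L * c * T' ≤ Q / κ := by
      have : Q / κ = L * E / κ + 2 * L * c * T := by
        rw [hQ, hc]
        field_simp
      rw [this]
      gcongr
    have h2 : Real.exp (L * T') ≤ Real.exp (L * T) := by
      apply Real.exp_le_exp.2
      gcongr
    calc (ρ + L * E / κ + 2 * L * c * T') * Real.exp (L * T')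
        ≤ (2 * ρ) * Real.exp (L * T) := by
          apply mul_le_mul _ h2 (Real.exp_pos _).le (by positivity)
          linarith
      _ = θ := hρθ
  have hdist : ∀ x z : Fin n → ℝ, ‖x - z‖ ≤ θ → einfDist x Ab ≤ einfDist z Ab + δ / 4 := by
    intro x z h
    have h1 := einfDist_le x z hAb
    have h2 := eunorm_le (x - z)
    have h3 : ((n : ℝ) + 1) * ‖x - z‖ ≤ (n + 1) * θ := by gcongr
    linarith
  have hnorm : ∀ x z : Fin n → ℝ, ‖x - z‖ ≤ θ → ‖z‖ ≤ Rz → ‖x‖ ≤ Rz + 1 := by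
    intro x z h h'
    have : ‖x‖ ≤ ‖z‖ + ‖x - z‖ := by simpa using norm_add_le z (x - z)
    linarith
  -- initial stage
  have hinit := track t₀ le_rfl T0 hT0 (le_max_left _ _) z0 hz0 hRzz (by
    simp only [hs]
    rw [hz00, hX0]
    exact hX₀m.le)
  have hbase : einfDist (s (t₀ + T0)) Ab ≤ δ / 2 := by
    have := hdist _ _ (hinit (t₀ + T0) ⟨by linarith, le_rfl⟩)
    linarith
  have hstep : ∀ a, t₀ ≤ a → einfDist (s a) Ab ≤ δ / 2 →
      (∀ t ∈ Set.Icc a (a + T1), ‖s t‖ ≤ Rz + 1 ∧ einfDist (s t) Ab ≤ η / 2) ∧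
        einfDist (s (a + T1)) Ab ≤ δ / 2 := by
    intro a ha hsa
    obtain ⟨z, hz0', hz⟩ := hex1 a (s a) hsa
    have hzs := hstab a z hz (by rw [hz0']; linarith)
    have hzt := hat1 a z hz (by rw [hz0']; exact hsa) (a + T1) le_rfl
    have htr := track a ha T1 hT1 (le_max_right _ _) z hz
      (fun t ht => hRze _ (hzs t ht.1)) (by rw [hz0']; simpa using hρ0.le)
    refine ⟨fun t ht => ⟨hnorm _ _ (htr t ht) (hRze _ (hzs t ht.1)), ?_⟩, ?_⟩
    · have := hdist _ _ (htr t ht)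
      linarith [hzs t ht.1]
    · have := hdist _ _ (htr (a + T1) ⟨by linarith, le_rfl⟩)
      linarith
  have hind : ∀ m : ℕ, einfDist (s (t₀ + T0 + m * T1)) Ab ≤ δ / 2 := by
    intro m
    induction m with
    | zero => simpa using hbase
    | succ m ih =>
      have h0 : 0 ≤ m * T1 := by positivity
      have := (hstep _ (by linarith) ih).2
      rw [show t₀ + T0 + m * T1 + T1 = t₀ + T0 + ((m + 1 : ℕ) : ℝ) * T1 by
        push_cast
        ring] at this
      exact this
  have hlate : ∀ t, t₀ + T0 ≤ t → ‖s t‖ ≤ Rz + 1 ∧ einfDist (s t) Ab ≤ η / 2 := by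
    intro t ht
    set m := ⌊(t - (t₀ + T0)) / T1⌋₊ with hm
    have h1 : (m : ℝ) ≤ (t - (t₀ + T0)) / T1 :=
      Nat.floor_le (div_nonneg (by linarith) hT1.le)
    have h2 : (t - (t₀ + T0)) / T1 < m + 1 := Nat.lt_floor_add_one _
    rw [le_div_iff₀ hT1] at h1
    rw [div_lt_iff₀ hT1] at h2
    have h0 : 0 ≤ m * T1 := by positivity
    exact (hstep (t₀ + T0 + m * T1) (by linarith) (hind m)).1 t ⟨by linarith, by linarith⟩
  have hsall : ∀ t, t₀ ≤ t → ‖s t‖ ≤ Rz + 1 := by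
    intro t ht
    rcases le_total t (t₀ + T0) with h | h
    · exact hnorm _ _ (hinit t ⟨ht, h⟩) (hRzz t ⟨ht, h⟩)
    · exact (hlate t h).1
  have hXR : ∀ t, t₀ ≤ t → ∀ i, ‖X t i‖ ≤ R := by
    intro t ht i
    have h1 : ‖X t i‖ ≤ ‖s t‖ + ‖X t i - s t‖ := by simpa using norm_add_le (s t) (X t i - s t)
    have h2 := hdisN t₀ le_rfl t ht i
    have h3 : E * Real.exp (-κ * (t - t₀)) ≤ E * 1 := by
      gcongr
      apply Real.exp_le_one_iff.2
      nlinarith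
    linarith [hsall t ht]
  have hlim : ∀ ε > 0, ∃ T : ℝ, ∀ t ≥ T, t₀ ≤ t ∧ E * Real.exp (-κ * (t - t₀)) ≤ ε := by
    intro ε hε
    have h1 : Tendsto (fun t => E * Real.exp (-κ * (t - t₀))) atTop (nhds (E * 0)) := by
      refine Tendsto.const_mul E (Real.tendsto_exp_atBot.comp ?_)
      refine Tendsto.const_mul_atTop_of_neg (by linarith) ?_
      exact tendsto_atTop_add_const_right _ (-t₀) tendsto_id
    rw [mul_zero] at h1
    have h2 := (h1.eventually (gt_mem_nhds hε)).and (eventually_ge_atTop t₀)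
    obtain ⟨T, hT⟩ := eventually_atTop.1 h2
    exact ⟨T, fun t ht => ⟨(hT t ht).2, (hT t ht).1.le⟩⟩
  refine ⟨fun i t => X t i, fun i => congrFun hX0 i, ?_, ?_, ?_⟩
  · intro i t ht
    have h := hasDerivAt_pi.1 (hX t ht) i
    rw [hφ _ (hXR t ht i)] at h
    exact h
  · intro i j ε hε
    obtain ⟨T, hT⟩ := hlim (ε / 2) (by positivity)
    refine ⟨T, fun t ht => ?_⟩
    obtain ⟨h1, h2⟩ := hT t ht
    have h3 := eunorm_add_le (X t i - s t) (-(X t j - s t))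
    rw [eunorm_neg, show X t i - s t + -(X t j - s t) = X t i - X t j by abel] at h3
    have := hdisE t h1 i
    have := hdisE t h1 j
    show eunorm (X t i - X t j) ≤ η + ε
    linarith
  · intro i ε hε
    obtain ⟨T, hT⟩ := hlim ε hε
    refine ⟨max T (t₀ + T0), fun t ht => ?_⟩
    obtain ⟨h1, h2⟩ := hT t ((le_max_left _ _).trans ht)
    have h3 := (hlate t ((le_max_right _ _).trans ht)).2
    have h4 := einfDist_le (X t i) (s t) hAb
    have := hdisE t h1 i
    show einfDist (X t i) Ab ≤ η + ε
    linarith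

theorem stmt1
    {N n : ℕ} (hN : 2 ≤ N) (t₀ : ℝ)
    (α : Fin N → Fin N → ℝ)
    (hsym : ∀ i j, α i j = α j i) (hnn : ∀ i j, 0 ≤ α i j) (hdiag : ∀ i, α i i = 0)
    (hpsd : (lapMat α).PosSemidef)
    (hconn : LinearMap.ker (lapMat α).mulVecLin
      = Submodule.span ℝ {(fun _ => 1 : Fin N → ℝ)})
    (f : Fin N → ℝ → (Fin n → ℝ) → Fin n → ℝ)
    (hreg : ∀ i, Reg (f i))
    (Ab Db : Set (Fin n → ℝ))
    (hAb : Ab.Nonempty) (hAbc : IsCompact Ab) (hDb : IsOpen Db) (hAD : Ab ⊆ Db)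
    (hUAS : UAS (fun t s => (N : ℝ)⁻¹ • ∑ i, f i t s) Ab Db)
    (K : Set (Fin N → Fin n → ℝ)) (hK : IsCompact K)
    (hKD : K ⊆ {X : Fin N → Fin n → ℝ | ∃ s ∈ Db, ∃ w : Fin N → Fin n → ℝ,
      (∑ i, w i = 0) ∧ X = fun i => s + w i})
    (η : ℝ) (hη : 0 < η) :
    ∃ kstar > (0:ℝ), ∀ k > kstar, ∀ X₀ ∈ K,
      ∃ x : Fin N → ℝ → Fin n → ℝ,
        (∀ i, x i t₀ = X₀ i) ∧
        (∀ i, ∀ t ≥ t₀, HasDerivAt (x i)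
          (f i t (x i t) + k • ∑ j, α i j • (x j t - x i t)) t) ∧
        (∀ i j, LimsupLE (fun t => eunorm (x i t - x j t)) η) ∧
        (∀ i, LimsupLE (fun t => einfDist (x i t) Ab) η) := by
  refine hK.induction_on (p := fun S => ∃ kstar > (0:ℝ), ∀ k > kstar, ∀ X₀ ∈ S,
      ∃ x : Fin N → ℝ → Fin n → ℝ,
        (∀ i, x i t₀ = X₀ i) ∧
        (∀ i, ∀ t ≥ t₀, HasDerivAt (x i)
          (f i t (x i t) + k • ∑ j, α i j • (x j t - x i t)) t) ∧
        (∀ i j, LimsupLE (fun t => eunorm (x i t - x j t)) η) ∧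
        (∀ i, LimsupLE (fun t => einfDist (x i t) Ab) η)) ?_ ?_ ?_ ?_
  · exact ⟨1, one_pos, fun k _ X₀ h => absurd h (Set.notMem_empty _)⟩
  · rintro S S' hS ⟨ks, hks, h⟩
    exact ⟨ks, hks, fun k hk X₀ hX => h k hk X₀ (hS hX)⟩
  · rintro S S' ⟨ks, hks, h⟩ ⟨ks', hks', h'⟩
    refine ⟨max ks ks', lt_max_of_lt_left hks, fun k hk X₀ hX => ?_⟩
    rcases hX with hX | hX
    · exact h k ((le_max_left _ _).trans_lt hk) X₀ hX
    · exact h' k ((le_max_right _ _).trans_lt hk) X₀ hX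
  · intro Xc hXc
    have hmem : meanV Xc ∈ Db := by
      obtain ⟨s, hs, w, hw, rfl⟩ := hKD hXc
      have hN0 : (N : ℝ) ≠ 0 := by positivity
      have : meanV (fun i => s + w i) = s := by
        unfold meanV
        rw [Finset.sum_add_distrib, hw, add_zero, Finset.sum_const, Finset.card_univ,
          Fintype.card_fin, ← Nat.cast_smul_eq_nsmul ℝ, smul_smul, inv_mul_cancel₀ hN0, one_smul]
      rwa [this]
    obtain ⟨U, hU, h⟩ := local_main hN t₀ α hsym hpsd hconn f hreg Ab Db hAb hAbc hDb hAD hUAS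
      Xc hmem η hη
    exact ⟨U, mem_nhdsWithin_of_mem_nhds hU, h⟩
end
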